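/- arXiv:2105.12058 — 7 statements merged into one kernel-verified Lean document; each statement's English description precedes it below -/
import Mathlib

section
/- Let 𝒞₁ and 𝒞₂ be irreducible conics in ℙ²(ℂ) meeting in four pairwise distinct points A, B, I′, J′. Suppose a line through A meets 𝒞₁ again at a point C and meets 𝒞₂ again at a point D, and a line through B meets 𝒞₁ again at a point E and meets 𝒞₂ again at a point F, where the eight points A, B, I′, J′, C, D, E, F are pairwise distinct. Then the three lines CE, DF, and I′J′ are concurrent, i.e., there is a point lying on all three of them. -/
open MvPolynomial

/-- Two nonzero vectors of `ℂ³` represent the same point of `ℙ²(ℂ)` iff they are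
proportional. -/
def ProjEq (v w : Fin 3 → ℂ) : Prop := ∃ c : ℂ, c ≠ 0 ∧ w = c • v


theorem aux_quad (q : MvPolynomial (Fin 3) ℂ) (hq : q.IsHomogeneous 2) :
    ∃ a b c d e f : ℂ, ∀ v : Fin 3 → ℂ, eval v q =
      a * v 0 ^ 2 + b * v 1 ^ 2 + c * v 2 ^ 2 + d * (v 0 * v 1) + e * (v 1 * v 2)
        + f * (v 2 * v 0) := by
  classical
  have key : ∀ m : Fin 3 →₀ ℕ, m.degree = 2 → ∀ r : ℂ,
      ∃ a b c d e f : ℂ, ∀ v : Fin 3 → ℂ, eval v (monomial m r) =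
      a * v 0 ^ 2 + b * v 1 ^ 2 + c * v 2 ^ 2 + d * (v 0 * v 1) + e * (v 1 * v 2)
        + f * (v 2 * v 0) := by
    intro m hm r
    have hm' : m 0 + m 1 + m 2 = 2 := by
      rw [Finsupp.degree_eq_sum, Fin.sum_univ_three] at hm
      exact hm
    have ev : ∀ v : Fin 3 → ℂ, eval v (monomial m r)
        = r * (v 0 ^ m 0 * v 1 ^ m 1 * v 2 ^ m 2) := by
      intro v
      rw [eval_monomial, Finsupp.prod_fintype _ _ (by simp), Fin.prod_univ_three]
    have h0 : m 0 ≤ 2 := by omega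
    have h1 : m 1 ≤ 2 := by omega
    have h2 : m 2 ≤ 2 := by omega
    simp only [ev]
    generalize m 0 = i at *
    generalize m 1 = j at *
    generalize m 2 = k at *
    have : (i = 2 ∧ j = 0 ∧ k = 0) ∨ (i = 0 ∧ j = 2 ∧ k = 0) ∨ (i = 0 ∧ j = 0 ∧ k = 2) ∨
      (i = 1 ∧ j = 1 ∧ k = 0) ∨ (i = 0 ∧ j = 1 ∧ k = 1) ∨ (i = 1 ∧ j = 0 ∧ k = 1) := by omega
    rcases this with ⟨rfl, rfl, rfl⟩ | ⟨rfl, rfl, rfl⟩ | ⟨rfl, rfl, rfl⟩ | ⟨rfl, rfl, rfl⟩ |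
      ⟨rfl, rfl, rfl⟩ | ⟨rfl, rfl, rfl⟩
    · exact ⟨r, 0, 0, 0, 0, 0, fun v => by ring⟩
    · exact ⟨0, r, 0, 0, 0, 0, fun v => by ring⟩
    · exact ⟨0, 0, r, 0, 0, 0, fun v => by ring⟩
    · exact ⟨0, 0, 0, r, 0, 0, fun v => by ring⟩
    · exact ⟨0, 0, 0, 0, r, 0, fun v => by ring⟩
    · exact ⟨0, 0, 0, 0, 0, r, fun v => by ring⟩
  have hsum : ∀ s : Finset (Fin 3 →₀ ℕ), (∀ m ∈ s, m.degree = 2) →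
      ∃ a b c d e f : ℂ, ∀ v : Fin 3 → ℂ, eval v (∑ m ∈ s, monomial m (coeff m q)) =
      a * v 0 ^ 2 + b * v 1 ^ 2 + c * v 2 ^ 2 + d * (v 0 * v 1) + e * (v 1 * v 2)
        + f * (v 2 * v 0) := by
    intro s
    induction s using Finset.induction_on with
    | empty => intro _; exact ⟨0, 0, 0, 0, 0, 0, fun v => by simp⟩
    | insert m s hms ih =>
      intro h
      obtain ⟨a, b, c, d, e, f, h1⟩ := ih (fun m hm => h m (Finset.mem_insert_of_mem hm))
      obtain ⟨a', b', c', d', e', f', h2⟩ := key m (h m (Finset.mem_insert_self _ _)) (coeff m q)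
      refine ⟨a + a', b + b', c + c', d + d', e + e', f + f', fun v => ?_⟩
      rw [Finset.sum_insert hms, map_add, h1, h2]
      ring
  have := hsum q.support (fun m hm => by
    by_contra hne
    exact (mem_support_iff.mp hm) (hq.coeff_eq_zero hne))
  rwa [support_sum_monomial_coeff] at this

/-- Expansion of a quadratic form in arbitrary coordinates. -/
theorem aux_quad_coord (q : MvPolynomial (Fin 3) ℂ) (hq : q.IsHomogeneous 2)
    (P Q R : Fin 3 → ℂ) :
    ∃ a b c : ℂ, ∀ x y z : ℂ, eval (x • P + y • Q + z • R) q =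
      x ^ 2 * eval P q + y ^ 2 * eval Q q + z ^ 2 * eval R q + a * (x * y) + b * (y * z)
        + c * (z * x) := by
  obtain ⟨a, b, c, d, e, f, h⟩ := aux_quad q hq
  refine ⟨2 * a * P 0 * Q 0 + 2 * b * P 1 * Q 1 + 2 * c * P 2 * Q 2
      + d * (P 0 * Q 1 + P 1 * Q 0) + e * (P 1 * Q 2 + P 2 * Q 1) + f * (P 2 * Q 0 + P 0 * Q 2),
    2 * a * R 0 * Q 0 + 2 * b * R 1 * Q 1 + 2 * c * R 2 * Q 2
      + d * (R 0 * Q 1 + R 1 * Q 0) + e * (R 1 * Q 2 + R 2 * Q 1) + f * (R 2 * Q 0 + R 0 * Q 2),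
    2 * a * P 0 * R 0 + 2 * b * P 1 * R 1 + 2 * c * P 2 * R 2
      + d * (P 0 * R 1 + P 1 * R 0) + e * (P 1 * R 2 + P 2 * R 1) + f * (P 2 * R 0 + P 0 * R 2),
    fun x y z => ?_⟩
  simp only [h, Pi.add_apply, Pi.smul_apply, smul_eq_mul]
  ring

theorem aux_linform (φ : (Fin 3 → ℂ) →ₗ[ℂ] ℂ) :
    ∃ p : MvPolynomial (Fin 3) ℂ, ∀ v, eval v p = φ v := by
  refine ⟨∑ i, C (φ (Pi.single i 1)) * X i, fun v => ?_⟩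
  rw [LinearMap.pi_apply_eq_sum_univ φ v]
  simp only [map_sum, map_mul, eval_C, eval_X, smul_eq_mul]
  refine Finset.sum_congr rfl fun i _ => ?_
  rw [mul_comm]
  congr 2
  ext j
  simp [Pi.single_apply, eq_comm]

theorem aux_coords (P Q R : Fin 3 → ℂ) (h : LinearIndependent ℂ ![P, Q, R]) :
    ∃ φ ψ χ : (Fin 3 → ℂ) →ₗ[ℂ] ℂ, ∀ v, v = φ v • P + ψ v • Q + χ v • R := by
  let b := basisOfLinearIndependentOfCardEqFinrank h (by simp)
  refine ⟨b.coord 0, b.coord 1, b.coord 2, fun v => ?_⟩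
  have := b.sum_repr v
  rw [Fin.sum_univ_three] at this
  simpa [b] using this.symm

theorem aux_noline (q : MvPolynomial (Fin 3) ℂ) (hq : q.IsHomogeneous 2) (hirr : Irreducible q)
    (P Q : Fin 3 → ℂ) (hPQ : LinearIndependent ℂ ![P, Q]) (hP : eval P q = 0)
    (hQ : eval Q q = 0) (x y : ℂ) (hx : x ≠ 0) (hy : y ≠ 0) : eval (x • P + y • Q) q ≠ 0 := by
  intro h0
  obtain ⟨R, hR⟩ := exists_linearIndependent_cons_of_lt_finrank hPQ (by simp)
  have hR' : LinearIndependent ℂ ![R, P, Q] := hR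
  obtain ⟨φ, ψ, χ, hv⟩ := aux_coords R P Q hR'
  obtain ⟨a, b, c, h⟩ := aux_quad_coord q hq R P Q
  have hb : b = 0 := by
    have := h 0 x y
    simp only [zero_smul, zero_add, h0, hP, hQ] at this
    have h2 : b * (x * y) = 0 := by linear_combination -this
    rcases mul_eq_zero.mp h2 with h3 | h3
    · exact h3
    · exact absurd h3 (mul_ne_zero hx hy)
  obtain ⟨p₁, hp₁⟩ := aux_linform φ
  obtain ⟨p₂, hp₂⟩ := aux_linform (eval R q • φ + a • ψ + c • χ)
  have hqe : q = p₁ * p₂ := by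
    apply MvPolynomial.funext
    intro v
    rw [map_mul, hp₁, hp₂]
    conv_lhs => rw [hv v]
    rw [h, hP, hQ, hb]
    simp only [LinearMap.add_apply, LinearMap.smul_apply, smul_eq_mul]
    ring
  rcases hirr.isUnit_or_isUnit hqe with hu | hu
  · have := hu.map (eval (0 : Fin 3 → ℂ))
    rw [hp₁] at this
    simp at this
  · have := hu.map (eval (0 : Fin 3 → ℂ))
    rw [hp₂] at this
    simp at this

theorem aux_pair (P Q : Fin 3 → ℂ) (hP : P ≠ 0) (hQ : Q ≠ 0) (h : ¬ ProjEq P Q) :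
    LinearIndependent ℂ ![P, Q] := by
  rw [LinearIndependent.pair_iff' hP]
  intro a ha
  refine h ⟨a, ?_, ha.symm⟩
  rintro rfl
  exact hQ (by simpa using ha.symm)

theorem aux_dep (P Q R : Fin 3 → ℂ) (hPQ : LinearIndependent ℂ ![P, Q])
    (h : ¬ LinearIndependent ℂ ![P, Q, R]) : ∃ x y : ℂ, R = x • P + y • Q := by
  rw [Fintype.not_linearIndependent_iff] at h
  obtain ⟨g, hg, i, hi⟩ := h
  simp only [Fin.sum_univ_three, Matrix.cons_val_zero, Matrix.cons_val_one, Matrix.cons_val] at hg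
  by_cases h2 : g 2 = 0
  · rw [h2, zero_smul, add_zero] at hg
    have := LinearIndependent.pair_iff.mp hPQ _ _ hg
    exfalso
    apply hi
    fin_cases i
    · exact this.1
    · exact this.2
    · exact h2
  · refine ⟨-(g 0 / g 2), -(g 1 / g 2), ?_⟩
    ext j
    have := congrFun hg j
    simp only [Pi.add_apply, Pi.smul_apply, smul_eq_mul, Pi.zero_apply] at this ⊢
    field_simp
    linear_combination this

/-- On an irreducible conic, a combination of two points is on the conic only if it is one of
them. -/
theorem aux_comb (q : MvPolynomial (Fin 3) ℂ) (hq : q.IsHomogeneous 2) (hirr : Irreducible q)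
    (P Q R : Fin 3 → ℂ) (hP0 : P ≠ 0) (hQ0 : Q ≠ 0) (hR0 : R ≠ 0)
    (hP : eval P q = 0) (hQ : eval Q q = 0) (hR : eval R q = 0)
    (hPQ : ¬ ProjEq P Q) (hPR : ¬ ProjEq P R) (hQR : ¬ ProjEq Q R) (x y : ℂ) :
    R ≠ x • P + y • Q := by
  intro h
  by_cases hx : x = 0
  · subst hx
    rw [zero_smul, zero_add] at h
    refine hQR ⟨y, ?_, h⟩
    rintro rfl
    exact hR0 (by simpa using h)
  by_cases hy : y = 0
  · subst hy
    rw [zero_smul, add_zero] at h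
    exact hPR ⟨x, hx, h⟩
  exact aux_noline q hq hirr P Q (aux_pair P Q hP0 hQ0 hPQ) hP hQ x y hx hy (h ▸ hR)

theorem aux_scalar (a b c a' b' c' c1 c2 c3 d1 t e1 e2 e3 f2 r : ℂ)
    (hs : a + b + c = 0) (hs' : a' + b' + c' = 0)
    (hC : c1 * (a * c2 + c * c3) = -(b * (c2 * c3)))
    (hD : d1 * (a' * c2 + c' * c3) = -(b' * t * (c2 * c3)))
    (hE : e2 * (a * e1 + b * e3) = -(c * (e1 * e3)))
    (hF : f2 * (a' * e1 + b' * e3) = -(c' * r * (e1 * e3)))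
    (h1 : a * c2 + c * c3 ≠ 0) (h2 : a' * c2 + c' * c3 ≠ 0)
    (h3 : a * e1 + b * e3 ≠ 0) (h4 : a' * e1 + b' * e3 ≠ 0) :
    ((c1 * e2 - c2 * e1) + (c2 * e3 - c3 * e2) + (c3 * e1 - c1 * e3))
      * (d1 * f2 - (t * c2) * (r * e1))
    = (c1 * e2 - c2 * e1) * ((d1 * f2 - (t * c2) * (r * e1)) + (t * c2 * (r * e3) - t * c3 * f2)
      + (t * c3 * (r * e1) - d1 * (r * e3))) := by
  have gen : ∀ L M n m x1 x2 x3 y1 y2 y3 : ℂ, x1 * L = n → y2 * M = m →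
      (x1 * y2 - x2 * y1) * (L * M) = n * m - (x2 * L) * (y1 * M) ∧
      ((x1 * y2 - x2 * y1) + (x2 * y3 - x3 * y2) + (x3 * y1 - x1 * y3)) * (L * M)
        = (n * m - (x2 * L) * (y1 * M)) + ((x2 * L) * (y3 * M) - x3 * L * m)
          + (x3 * L * (y1 * M) - n * (y3 * M)) := by
    rintro L M n m x1 x2 x3 y1 y2 y3 rfl rfl
    constructor <;> ring
  obtain ⟨g1, g2⟩ := gen _ _ _ _ c1 c2 c3 e1 e2 e3 hC hE
  obtain ⟨g3, g4⟩ := gen _ _ _ _ d1 (t * c2) (t * c3) (r * e1) f2 (r * e3) hD hF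
  apply mul_left_cancel₀ (mul_ne_zero (mul_ne_zero h1 h3) (mul_ne_zero h2 h4))
  have e : ∀ x y x' y' p q : ℂ, (x * p) * (y * q) = (x' * p) * (y' * q) →
      p * q * (x * y) = p * q * (x' * y') := fun x y x' y' p q h => by linear_combination h
  apply e
  rw [g1, g2, g3, g4]
  obtain rfl : b = -a - c := by linear_combination hs
  obtain rfl : b' = -a' - c' := by linear_combination hs'
  ring

theorem aux_ne (a b c c1 c2 c3 : ℂ) (ha : a ≠ 0) (hb : b ≠ 0) (hc : c ≠ 0)
    (hC : c1 * (a * c2 + c * c3) = -(b * (c2 * c3))) (h : ¬ (c2 = 0 ∧ c3 = 0)) :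
    a * c2 + c * c3 ≠ 0 := by
  intro h0
  rw [h0] at hC
  have : c2 * c3 = 0 := by
    have : b * (c2 * c3) = 0 := by linear_combination hC
    simpa [hb] using this
  rcases mul_eq_zero.mp this with h1 | h1
  · rw [h1] at h0
    exact h ⟨h1, by simpa [hc] using h0⟩
  · rw [h1] at h0
    exact h ⟨by simpa [ha] using h0, h1⟩

/-- **Lemma on two conics.** Let `𝒞₁ = {q₁ = 0}` and `𝒞₂ = {q₂ = 0}` be irreducible
conics in `ℙ²(ℂ)` meeting in exactly four pairwise distinct points `A, B, I', J'`.
Suppose a line through `A` meets `𝒞₁` again at `C` and `𝒞₂` again at `D`, and a line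
through `B` meets `𝒞₁` again at `E` and `𝒞₂` again at `F`, the eight points being
pairwise distinct.  Then the lines `CE`, `DF` and `I'J'` are concurrent. -/
theorem conics_lines_concurrent
    (q₁ q₂ : MvPolynomial (Fin 3) ℂ)
    (hq₁0 : q₁ ≠ 0) (hq₂0 : q₂ ≠ 0)
    (hq₁h : q₁.IsHomogeneous 2) (hq₂h : q₂.IsHomogeneous 2)
    (hq₁irr : Irreducible q₁) (hq₂irr : Irreducible q₂)
    (A B I' J' C D E F : Fin 3 → ℂ)
    (hA : A ≠ 0) (hB : B ≠ 0) (hI' : I' ≠ 0) (hJ' : J' ≠ 0)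
    (hC : C ≠ 0) (hD : D ≠ 0) (hE : E ≠ 0) (hF : F ≠ 0)
    -- the four points lie on both conics
    (hA₁ : eval A q₁ = 0) (hA₂ : eval A q₂ = 0)
    (hB₁ : eval B q₁ = 0) (hB₂ : eval B q₂ = 0)
    (hI'₁ : eval I' q₁ = 0) (hI'₂ : eval I' q₂ = 0)
    (hJ'₁ : eval J' q₁ = 0) (hJ'₂ : eval J' q₂ = 0)
    -- and they are the only intersection points of the two conics
    (hmeet : ∀ v : Fin 3 → ℂ, v ≠ 0 → eval v q₁ = 0 → eval v q₂ = 0 →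
      ProjEq v A ∨ ProjEq v B ∨ ProjEq v I' ∨ ProjEq v J')
    -- a line through A meets 𝒞₁ again at C and 𝒞₂ again at D
    (hC₁ : eval C q₁ = 0) (hD₂ : eval D q₂ = 0)
    (hACD : ¬ LinearIndependent ℂ ![A, C, D])
    -- a line through B meets 𝒞₁ again at E and 𝒞₂ again at F
    (hE₁ : eval E q₁ = 0) (hF₂ : eval F q₂ = 0)
    (hBEF : ¬ LinearIndependent ℂ ![B, E, F])
    -- the eight points are pairwise distinct
    (hdist : ∀ i j : Fin 8, i ≠ j →
      ¬ ProjEq (![A, B, I', J', C, D, E, F] i) (![A, B, I', J', C, D, E, F] j)) :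
    ∃ X : Fin 3 → ℂ, X ≠ 0 ∧
      X ∈ Submodule.span ℂ ({C, E} : Set (Fin 3 → ℂ)) ∧
      X ∈ Submodule.span ℂ ({D, F} : Set (Fin 3 → ℂ)) ∧
      X ∈ Submodule.span ℂ ({I', J'} : Set (Fin 3 → ℂ)) := by
  have nAB : ¬ ProjEq A B := hdist 0 1 (by decide)
  have nAI : ¬ ProjEq A I' := hdist 0 2 (by decide)
  have nAJ : ¬ ProjEq A J' := hdist 0 3 (by decide)
  have nAC : ¬ ProjEq A C := hdist 0 4 (by decide)
  have nAD : ¬ ProjEq A D := hdist 0 5 (by decide)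
  have nBI : ¬ ProjEq B I' := hdist 1 2 (by decide)
  have nBJ : ¬ ProjEq B J' := hdist 1 3 (by decide)
  have nBE : ¬ ProjEq B E := hdist 1 6 (by decide)
  have nBF : ¬ ProjEq B F := hdist 1 7 (by decide)
  have nIJ : ¬ ProjEq I' J' := hdist 2 3 (by decide)
  have nIC : ¬ ProjEq I' C := hdist 2 4 (by decide)
  have nJC : ¬ ProjEq J' C := hdist 3 4 (by decide)
  have nID : ¬ ProjEq I' D := hdist 2 5 (by decide)
  have nJD : ¬ ProjEq J' D := hdist 3 5 (by decide)
  have nCE : ¬ ProjEq C E := hdist 4 6 (by decide)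
  have nDF : ¬ ProjEq D F := hdist 5 7 (by decide)
  have hABI : LinearIndependent ℂ ![A, B, I'] := by
    by_contra hn
    obtain ⟨x, y, h⟩ := aux_dep A B I' (aux_pair A B hA hB nAB) hn
    exact aux_comb q₁ hq₁h hq₁irr A B I' hA hB hI' hA₁ hB₁ hI'₁ nAB nAI nBI x y h
  obtain ⟨φ, ψ, χ, hv⟩ := aux_coords A B I' hABI
  have hJv := hv J'
  have hα : φ J' ≠ 0 := by
    intro h
    rw [h, zero_smul, zero_add] at hJv
    exact aux_comb q₁ hq₁h hq₁irr B I' J' hB hI' hJ' hB₁ hI'₁ hJ'₁ nBI nBJ nIJ _ _ hJv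
  have hβ : ψ J' ≠ 0 := by
    intro h
    rw [h, zero_smul, add_zero] at hJv
    exact aux_comb q₁ hq₁h hq₁irr A I' J' hA hI' hJ' hA₁ hI'₁ hJ'₁ nAI nAJ nIJ _ _ hJv
  have hγ : χ J' ≠ 0 := by
    intro h
    rw [h, zero_smul, add_zero] at hJv
    exact aux_comb q₁ hq₁h hq₁irr A B J' hA hB hJ' hA₁ hB₁ hJ'₁ nAB nAJ nBJ _ _ hJv
  generalize φ J' = α at *
  generalize ψ J' = β at *
  generalize χ J' = γ at *
  -- the rescaled basis
  have hco : ∀ v, ∃ x y z : ℂ, v = x • (α • A) + y • (β • B) + z • (γ • I') := by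
    intro v
    refine ⟨φ v / α, ψ v / β, χ v / γ, ?_⟩
    simp only [smul_smul, div_mul_cancel₀ _ hα, div_mul_cancel₀ _ hβ, div_mul_cancel₀ _ hγ]
    exact hv v
  -- equations of the conics
  have conic : ∀ q : MvPolynomial (Fin 3) ℂ, q.IsHomogeneous 2 → Irreducible q →
      eval A q = 0 → eval B q = 0 → eval I' q = 0 → eval J' q = 0 →
      ∃ a b c : ℂ, a ≠ 0 ∧ b ≠ 0 ∧ c ≠ 0 ∧ a + b + c = 0 ∧ ∀ x y z : ℂ,
        eval (x • (α • A) + y • (β • B) + z • (γ • I')) q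
          = a * (x * y) + b * (y * z) + c * (z * x) := by
    intro q hq hirr qA qB qI qJ
    obtain ⟨a, b, c, h⟩ := aux_quad_coord q hq A B I'
    have h' : ∀ x y z : ℂ, eval (x • (α • A) + y • (β • B) + z • (γ • I')) q
          = (a * α * β) * (x * y) + (b * β * γ) * (y * z) + (c * γ * α) * (z * x) := by
      intro x y z
      simp only [smul_smul, h, qA, qB, qI]
      ring
    refine ⟨a * α * β, b * β * γ, c * γ * α, ?_, ?_, ?_, ?_, h'⟩
    · refine mul_ne_zero (mul_ne_zero ?_ hα) hβ
      rintro rfl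
      refine aux_noline q hq hirr A B (aux_pair A B hA hB nAB) qA qB 1 1 one_ne_zero one_ne_zero ?_
      have := h 1 1 0
      simpa [qA, qB] using this
    · refine mul_ne_zero (mul_ne_zero ?_ hβ) hγ
      rintro rfl
      refine aux_noline q hq hirr B I' (aux_pair B I' hB hI' nBI) qB qI 1 1 one_ne_zero
        one_ne_zero ?_
      have := h 0 1 1
      simpa [qI, qB] using this
    · refine mul_ne_zero (mul_ne_zero ?_ hγ) hα
      rintro rfl
      refine aux_noline q hq hirr A I' (aux_pair A I' hA hI' nAI) qA qI 1 1 one_ne_zero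
        one_ne_zero ?_
      have := h 1 0 1
      simpa [qI, qA] using this
    · have := h' 1 1 1
      simp only [one_smul, ← hJv, qJ] at this
      linear_combination -this
  obtain ⟨a, b, c, ha, hb, hc, hs, hQ⟩ := conic q₁ hq₁h hq₁irr hA₁ hB₁ hI'₁ hJ'₁
  obtain ⟨a', b', c', ha', hb', hc', hs', hQ'⟩ := conic q₂ hq₂h hq₂irr hA₂ hB₂ hI'₂ hJ'₂
  obtain ⟨s, t, hDe⟩ := aux_dep A C D (aux_pair A C hA hC nAC) hACD
  obtain ⟨s', r, hFe⟩ := aux_dep B E F (aux_pair B E hB hE nBE) hBEF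
  have ht : t ≠ 0 := by
    rintro rfl
    rw [zero_smul, add_zero] at hDe
    refine nAD ⟨s, ?_, hDe⟩
    rintro rfl
    exact hD (by simpa using hDe)
  have hr : r ≠ 0 := by
    rintro rfl
    rw [zero_smul, add_zero] at hFe
    refine nBF ⟨s', ?_, hFe⟩
    rintro rfl
    exact hF (by simpa using hFe)
  obtain ⟨c1, c2, c3, hCc⟩ := hco C
  obtain ⟨e1, e2, e3, hEc⟩ := hco E
  obtain ⟨d1, hDc⟩ : ∃ d1 : ℂ, D = d1 • (α • A) + (t * c2) • (β • B) + (t * c3) • (γ • I') := by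
    refine ⟨s / α + t * c1, ?_⟩
    rw [hDe, hCc]
    ext j
    simp only [Pi.add_apply, Pi.smul_apply, smul_eq_mul]
    field_simp
    ring
  obtain ⟨f2, hFc⟩ : ∃ f2 : ℂ, F = (r * e1) • (α • A) + f2 • (β • B) + (r * e3) • (γ • I') := by
    refine ⟨s' / β + r * e2, ?_⟩
    rw [hFe, hEc]
    ext j
    simp only [Pi.add_apply, Pi.smul_apply, smul_eq_mul]
    field_simp
    ring
  have nC0 : ¬ (c2 = 0 ∧ c3 = 0) := by
    rintro ⟨rfl, rfl⟩
    rw [zero_smul, zero_smul, add_zero, add_zero, smul_smul] at hCc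
    refine nAC ⟨c1 * α, fun h => hC ?_, hCc⟩
    rw [hCc, h, zero_smul]
  have nE0 : ¬ (e1 = 0 ∧ e3 = 0) := by
    rintro ⟨rfl, rfl⟩
    rw [zero_smul, zero_smul, zero_add, add_zero, smul_smul] at hEc
    refine nBE ⟨e2 * β, fun h => hE ?_, hEc⟩
    rw [hEc, h, zero_smul]
  have eC : c1 * (a * c2 + c * c3) = -(b * (c2 * c3)) := by
    have := hQ c1 c2 c3
    rw [← hCc, hC₁] at this
    linear_combination -this
  have eE : e2 * (a * e1 + b * e3) = -(c * (e1 * e3)) := by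
    have := hQ e1 e2 e3
    rw [← hEc, hE₁] at this
    linear_combination -this
  have eD : d1 * (a' * c2 + c' * c3) = -(b' * t * (c2 * c3)) := by
    have := hQ' d1 (t * c2) (t * c3)
    rw [← hDc, hD₂] at this
    apply mul_left_cancel₀ ht
    linear_combination -this
  have eF : f2 * (a' * e1 + b' * e3) = -(c' * r * (e1 * e3)) := by
    have := hQ' (r * e1) f2 (r * e3)
    rw [← hFc, hF₂] at this
    apply mul_left_cancel₀ hr
    linear_combination -this
  have key := aux_scalar a b c a' b' c' c1 c2 c3 d1 t e1 e2 e3 f2 r hs hs' eC eD eE eF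
    (aux_ne a b c c1 c2 c3 ha hb hc eC nC0)
    (aux_ne a' (b' * t) c' d1 c2 c3 ha' (mul_ne_zero hb' ht) hc' eD nC0)
    (aux_ne a c b e2 e1 e3 ha hc hb eE nE0)
    (aux_ne a' (c' * r) b' f2 e1 e3 ha' (mul_ne_zero hc' hr) hb' eF nE0)
  have hC12 : c1 - c2 ≠ 0 := by
    intro h
    obtain rfl : c2 = c1 := by linear_combination -h
    refine aux_comb q₁ hq₁h hq₁irr I' J' C hI' hJ' hC hI'₁ hJ'₁ hC₁ nIJ nIC nJC
      ((c3 - c2) * γ) c2 ?_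
    rw [hJv, hCc]
    ext j
    simp only [Pi.add_apply, Pi.smul_apply, smul_eq_mul]
    ring
  have hD12 : d1 - t * c2 ≠ 0 := by
    intro h
    obtain rfl : d1 = t * c2 := by linear_combination h
    refine aux_comb q₂ hq₂h hq₂irr I' J' D hI' hJ' hD hI'₂ hJ'₂ hD₂ nIJ nID nJD
      ((t * c3 - t * c2) * γ) (t * c2) ?_
    rw [hJv, hDc]
    ext j
    simp only [Pi.add_apply, Pi.smul_apply, smul_eq_mul]
    ring
  -- the intersection of the line `PQ` with `I'J'`
  have meet : ∀ p1 p2 p3 r1 r2 r3 : ℂ,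
      (((p1 * r2 - p2 * r1) + (p2 * r3 - p3 * r2) + (p3 * r1 - p1 * r3)) * γ) • I'
        - (p1 * r2 - p2 * r1) • J'
      = (r1 - r2) • (p1 • (α • A) + p2 • (β • B) + p3 • (γ • I'))
        - (p1 - p2) • (r1 • (α • A) + r2 • (β • B) + r3 • (γ • I')) := by
    intro p1 p2 p3 r1 r2 r3
    rw [hJv]
    ext j
    simp only [Pi.add_apply, Pi.sub_apply, Pi.smul_apply, smul_eq_mul]
    ring
  have m1 := meet c1 c2 c3 e1 e2 e3
  have m2 := meet d1 (t * c2) (t * c3) (r * e1) f2 (r * e3)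
  rw [← hCc, ← hEc] at m1
  rw [← hDc, ← hFc] at m2
  have pCE := LinearIndependent.pair_iff.mp (aux_pair C E hC hE nCE)
  have pDF := LinearIndependent.pair_iff.mp (aux_pair D F hD hF nDF)
  have memsp : ∀ (P Q : Fin 3 → ℂ) (x y : ℂ),
      x • P - y • Q ∈ Submodule.span ℂ ({P, Q} : Set (Fin 3 → ℂ)) := by
    intro P Q x y
    exact Submodule.sub_mem _ (Submodule.smul_mem _ _ (Submodule.subset_span (by simp)))
      (Submodule.smul_mem _ _ (Submodule.subset_span (by simp)))
  generalize (c1 * e2 - c2 * e1) + (c2 * e3 - c3 * e2) + (c3 * e1 - c1 * e3) = u at *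
  generalize c1 * e2 - c2 * e1 = w at *
  generalize (d1 * f2 - (t * c2) * (r * e1)) + (t * c2 * (r * e3) - t * c3 * f2)
      + (t * c3 * (r * e1) - d1 * (r * e3)) = u' at *
  generalize d1 * f2 - (t * c2) * (r * e1) = w' at *
  have hne : (u * γ) • I' - w • J' ≠ 0 := by
    rw [m1]
    intro h
    rw [sub_eq_add_neg, ← neg_smul] at h
    exact hC12 (neg_eq_zero.mp (pCE _ _ h).2)
  have hne' : (u' * γ) • I' - w' • J' ≠ 0 := by
    rw [m2]
    intro h
    rw [sub_eq_add_neg, ← neg_smul] at h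
    exact hD12 (neg_eq_zero.mp (pDF _ _ h).2)
  obtain ⟨k, hk⟩ : ∃ k : ℂ, (u * γ) • I' - w • J' = k • ((u' * γ) • I' - w' • J') := by
    by_cases hw : w' = 0
    · have hu' : u' ≠ 0 := by
        rintro rfl
        apply hne'
        simp [hw]
      have hw0 : w = 0 := by
        rw [hw, mul_zero] at key
        exact (mul_eq_zero.mp key.symm).resolve_right hu'
      refine ⟨u / u', ?_⟩
      rw [hw, hw0, zero_smul, sub_zero, sub_zero, smul_smul]
      congr 1
      field_simp
    · refine ⟨w / w', ?_⟩
      have : u = w / w' * u' := by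
        field_simp
        linear_combination key
      rw [this]
      ext j
      simp only [Pi.sub_apply, Pi.smul_apply, smul_eq_mul]
      field_simp
  refine ⟨(u * γ) • I' - w • J', hne, ?_, ?_, memsp _ _ _ _⟩
  · rw [m1]
    exact memsp _ _ _ _
  · rw [hk, m2]
    exact Submodule.smul_mem _ _ (memsp _ _ _ _)
end

section
/- Let two distinct circles in the Euclidean plane ℝ² meet at two distinct points A and B. Suppose a line through A meets the first circle again at a point C ≠ A and meets the second circle again at a point D ≠ A, and a line through B meets the first circle again at a point E ≠ B and meets the second circle again at a point F ≠ B. If C ≠ E and D ≠ F, then the line through C and E is parallel to the line through D and F. -/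
open Metric AffineSubspace

theorem perp_param (b1 b2 p1 p2 : ℝ) (hb : b1 ^ 2 + b2 ^ 2 ≠ 0)
    (h : b1 ^ 2 + b2 ^ 2 = 2 * (p1 * b1 + p2 * b2)) :
    ∃ α : ℝ, p1 = b1 / 2 - α * b2 ∧ p2 = b2 / 2 + α * b1 := by
  refine ⟨(b1 * p2 - b2 * p1) / (b1 ^ 2 + b2 ^ 2), ?_, ?_⟩
  · field_simp
    linear_combination (-b1) * h
  · field_simp
    linear_combination (-b2) * h

/-- Coordinates relative to `A`: `b = B - A`, `p, q` the centers, `u = C - A`, `v = E - B`. -/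
theorem cross_zero (b1 b2 p1 p2 q1 q2 u1 u2 v1 v2 l m : ℝ)
    (hb : b1 ^ 2 + b2 ^ 2 ≠ 0) (hu : u1 ^ 2 + u2 ^ 2 ≠ 0) (hv : v1 ^ 2 + v2 ^ 2 ≠ 0)
    (hp : b1 ^ 2 + b2 ^ 2 = 2 * (p1 * b1 + p2 * b2))
    (hq : b1 ^ 2 + b2 ^ 2 = 2 * (q1 * b1 + q2 * b2))
    (h1 : u1 ^ 2 + u2 ^ 2 = 2 * (p1 * u1 + p2 * u2))
    (h2 : l * (u1 ^ 2 + u2 ^ 2) = 2 * (q1 * u1 + q2 * u2))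
    (h3 : v1 ^ 2 + v2 ^ 2 = 2 * ((p1 - b1) * v1 + (p2 - b2) * v2))
    (h4 : m * (v1 ^ 2 + v2 ^ 2) = 2 * ((q1 - b1) * v1 + (q2 - b2) * v2)) :
    (b1 + v1 - u1) * (b2 + m * v2 - l * u2) - (b2 + v2 - u2) * (b1 + m * v1 - l * u1) = 0 := by
  obtain ⟨α, rfl, rfl⟩ := perp_param b1 b2 p1 p2 hb hp
  obtain ⟨β, rfl, rfl⟩ := perp_param b1 b2 q1 q2 hb hq
  obtain ⟨s, hs, hs1⟩ : ∃ s : ℝ, s = 1 ∧ s = 2 * ((b1 / 2 - α * b2) * u1 + (b2 / 2 + α * b1) * u2) / (u1 ^ 2 + u2 ^ 2) :=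
    ⟨1, rfl, by rw [eq_div_iff hu]; linarith⟩
  obtain ⟨t, ht, ht1⟩ : ∃ t : ℝ, t = 1 ∧ t = 2 * ((b1 / 2 - α * b2 - b1) * v1 + (b2 / 2 + α * b1 - b2) * v2) / (v1 ^ 2 + v2 ^ 2) :=
    ⟨1, rfl, by rw [eq_div_iff hv]; linarith⟩
  have hl := (eq_div_iff hu).2 h2
  have hm := (eq_div_iff hv).2 h4
  have key : (b1 + t * v1 - s * u1) * (b2 + m * v2 - l * u2)
      - (b2 + t * v2 - s * u2) * (b1 + m * v1 - l * u1) = 0 := by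
    rw [hs1, ht1, hl, hm]
    field_simp
    ring
  rw [hs, ht] at key
  linarith

theorem sq_ne (x y : EuclideanSpace ℝ (Fin 2)) (h : x ≠ y) :
    (x 0 - y 0) ^ 2 + (x 1 - y 1) ^ 2 ≠ 0 := by
  intro h0
  apply h
  ext i
  fin_cases i
  · show x 0 = y 0
    nlinarith [sq_nonneg (x 0 - y 0), sq_nonneg (x 1 - y 1)]
  · show x 1 = y 1
    nlinarith [sq_nonneg (x 0 - y 0), sq_nonneg (x 1 - y 1)]

theorem mem_sph (x o : EuclideanSpace ℝ (Fin 2)) (r : ℝ) (h : x ∈ sphere o r) :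
    (x 0 - o 0) ^ 2 + (x 1 - o 1) ^ 2 = r ^ 2 := by
  rw [mem_sphere, EuclideanSpace.dist_eq] at h
  rw [← h, Real.sq_sqrt (by positivity)]
  simp [Fin.sum_univ_two, Real.dist_eq, sq_abs]

theorem col_param (x y z : EuclideanSpace ℝ (Fin 2)) (hyx : y ≠ x)
    (h : Collinear ℝ {x, y, z}) :
    ∃ l : ℝ, ∀ i, z i = x i + l * (y i - x i) := by
  have hz : z ∈ line[ℝ, x, y] :=
    h.mem_affineSpan_of_mem_of_ne (by simp) (by simp) (by simp) hyx.symm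
  rw [← vsub_vadd z x, vadd_left_mem_affineSpan_pair] at hz
  obtain ⟨l, hl⟩ := hz
  refine ⟨l, fun i => ?_⟩
  have h1 := congrArg (fun w : EuclideanSpace ℝ (Fin 2) => w i) hl
  simp at h1
  linarith

theorem par_of_cross (C E D F : EuclideanSpace ℝ (Fin 2)) (hCE : C ≠ E) (hDF : D ≠ F)
    (h : (E 0 - C 0) * (F 1 - D 1) - (E 1 - C 1) * (F 0 - D 0) = 0) :
    AffineSubspace.Parallel (affineSpan ℝ {C, E}) (affineSpan ℝ {D, F}) := by
  rw [affineSpan_pair_parallel_iff_vectorSpan_eq, vectorSpan_pair, vectorSpan_pair]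
  have hn := sq_ne C E hCE
  have hn' := sq_ne D F hDF
  have hk : F -ᵥ D ≠ 0 := by rw [vsub_ne_zero]; exact hDF.symm
  have hv : D -ᵥ F = (((C 0 - E 0) * (D 0 - F 0) + (C 1 - E 1) * (D 1 - F 1)) /
      ((C 0 - E 0) ^ 2 + (C 1 - E 1) ^ 2)) • (C -ᵥ E) := by
    ext i
    fin_cases i
    · simp
      field_simp
      linear_combination (-(C 1 - E 1)) * h
    · simp
      field_simp
      linear_combination (C 0 - E 0) * h
  rw [hv]
  refine (Submodule.span_singleton_smul_eq (IsUnit.mk0 _ ?_) _).symm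
  intro h0
  rw [h0, zero_smul, vsub_eq_zero_iff_eq] at hv
  exact hDF hv



/-- Two distinct circles in the Euclidean plane meet at distinct points `A` and `B`.
A line through `A` meets the first circle again at `C ≠ A` and the second again at
`D ≠ A`; a line through `B` meets the first circle again at `E ≠ B` and the second
again at `F ≠ B`.  If `C ≠ E` and `D ≠ F` then line `CE` is parallel to line `DF`. -/
theorem lines_parallel_of_two_circles
    (O₁ O₂ : EuclideanSpace ℝ (Fin 2)) (r₁ r₂ : ℝ)
    (hr₁ : 0 < r₁) (hr₂ : 0 < r₂)
    (hcirc : sphere O₁ r₁ ≠ sphere O₂ r₂)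
    (A B C D E F : EuclideanSpace ℝ (Fin 2))
    (hAB : A ≠ B)
    (hA₁ : A ∈ sphere O₁ r₁) (hA₂ : A ∈ sphere O₂ r₂)
    (hB₁ : B ∈ sphere O₁ r₁) (hB₂ : B ∈ sphere O₂ r₂)
    (hC : C ∈ sphere O₁ r₁) (hD : D ∈ sphere O₂ r₂)
    (hCA : C ≠ A) (hDA : D ≠ A)
    (hACD : Collinear ℝ {A, C, D})
    (hE : E ∈ sphere O₁ r₁) (hF : F ∈ sphere O₂ r₂)
    (hEB : E ≠ B) (hFB : F ≠ B)
    (hBEF : Collinear ℝ {B, E, F})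
    (hCE : C ≠ E) (hDF : D ≠ F) :
    AffineSubspace.Parallel (affineSpan ℝ {C, E}) (affineSpan ℝ {D, F}) := by
  obtain ⟨l, hl⟩ := col_param A C D hCA hACD
  obtain ⟨m, hm⟩ := col_param B E F hEB hBEF
  have a1 := mem_sph _ _ _ hA₁
  have a2 := mem_sph _ _ _ hA₂
  have b1 := mem_sph _ _ _ hB₁
  have b2 := mem_sph _ _ _ hB₂
  have c1 := mem_sph _ _ _ hC
  have d2 := mem_sph _ _ _ hD
  have e1 := mem_sph _ _ _ hE
  have f2 := mem_sph _ _ _ hF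
  have hl0 : l ≠ 0 := by
    rintro rfl
    exact hDA (by ext i; simp [hl i])
  have hm0 : m ≠ 0 := by
    rintro rfl
    exact hFB (by ext i; simp [hm i])
  rw [hl 0, hl 1] at d2
  rw [hm 0, hm 1] at f2
  apply par_of_cross C E D F hCE hDF
  have key := cross_zero (B 0 - A 0) (B 1 - A 1) (O₁ 0 - A 0) (O₁ 1 - A 1)
    (O₂ 0 - A 0) (O₂ 1 - A 1) (C 0 - A 0) (C 1 - A 1) (E 0 - B 0) (E 1 - B 1) l m
    (sq_ne _ _ hAB.symm) (sq_ne _ _ hCA) (sq_ne _ _ hEB)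
    (by linear_combination b1 - a1) (by linear_combination b2 - a2)
    (by linear_combination c1 - a1)
    (by apply mul_left_cancel₀ hl0; linear_combination d2 - a2)
    (by linear_combination e1 - b1)
    (by apply mul_left_cancel₀ hm0; linear_combination f2 - b2)
  rw [hl 0, hl 1, hm 0, hm 1]
  linear_combination key
end

section
/- Let F₁, F₂, G₁, G₂ be nonzero homogeneous degree-2 polynomials in ℂ[x,y,z], and suppose the projective zero sets of F₁·F₂ and of G₁·G₂ in ℙ²(ℂ) intersect in exactly 16 pairwise distinct points. Partition these 16 points into a set S of 10 points and a set T of the remaining 6 points. Then there exists a nonzero homogeneous degree-3 polynomial in ℂ[x,y,z] vanishing at all 10 points of S if and only if there exists a nonzero homogeneous degree-2 polynomial in ℂ[x,y,z] vanishing at all 6 points of T. -/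
open MvPolynomial

open scoped Matrix

theorem pairLI {p q : Fin 3 → ℂ} (hp : p ≠ 0) (hq : q ≠ 0) (h : ¬ ProjEq p q) :
    LinearIndependent ℂ ![p, q] := by
  rw [LinearIndependent.pair_iff' hp]
  intro a ha
  apply h
  refine ⟨a, ?_, ha.symm⟩
  rintro rfl
  apply hq
  simpa using ha.symm

/-- linear form with given coefficients -/
noncomputable def linF : (Fin 3 → ℂ) →ₗ[ℂ] MvPolynomial (Fin 3) ℂ where
  toFun a := ∑ i, C (a i) * X i
  map_add' a b := by simp [add_mul, Finset.sum_add_distrib]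
  map_smul' c a := by simp [Finset.smul_sum, smul_eq_C_mul, mul_assoc]

theorem linF_hom (a : Fin 3 → ℂ) : (linF a).IsHomogeneous 1 := by
  apply IsHomogeneous.sum
  intro i _
  exact isHomogeneous_C_mul_X _ _

theorem linF_eval (a w : Fin 3 → ℂ) : eval w (linF a) = a ⬝ᵥ w := by
  simp [linF, dotProduct]

theorem dot3 {p q r a : Fin 3 → ℂ} (h : Matrix.det ![p, q, r] ≠ 0)
    (hp : a ⬝ᵥ p = 0) (hq : a ⬝ᵥ q = 0) (hr : a ⬝ᵥ r = 0) : a = 0 := by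
  apply Matrix.eq_zero_of_mulVec_eq_zero h
  ext i
  fin_cases i <;> simp [Matrix.mulVec] <;> rw [dotProduct_comm] <;> assumption

theorem det_of_LI {p q r : Fin 3 → ℂ} (h : LinearIndependent ℂ ![p, q, r]) :
    Matrix.det ![p, q, r] ≠ 0 := by
  have := (Matrix.linearIndependent_rows_iff_isUnit (A := Matrix.of ![p, q, r])).1 h
  exact ((Matrix.isUnit_iff_isUnit_det _).1 this).ne_zero

theorem linF_ne {a : Fin 3 → ℂ} (h : a ≠ 0) : linF a ≠ 0 := by
  intro h0
  apply h
  ext i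
  have := linF_eval a (Pi.single i 1)
  rw [h0] at this
  simpa using this.symm

theorem LI3 {p q r : Fin 3 → ℂ} (hpq : LinearIndependent ℂ ![p, q])
    (hr : r ∉ Submodule.span ℂ {p, q}) : LinearIndependent ℂ ![p, q, r] := by
  have := (linearIndependent_finSnoc (v := ![p, q]) (x := r)).2 ⟨hpq, by simpa [Set.pair_comm] using hr⟩
  have e : (Fin.snoc ![p, q] r : Fin 3 → Fin 3 → ℂ) = ![p, q, r] := by
    ext i j; fin_cases i <;> rfl
  rw [← e]; exact this

theorem sep {p q : Fin 3 → ℂ} (hp : p ≠ 0) (hq : q ≠ 0) (h : ¬ ProjEq p q) :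
    ∃ a : Fin 3 → ℂ, a ⬝ᵥ q = 0 ∧ a ⬝ᵥ p ≠ 0 := by
  have hli := pairLI hp hq h
  obtain ⟨r, hr⟩ : ∃ r, r ∉ Submodule.span ℂ {p, q} := by
    by_contra! hc
    have h1 : Submodule.span ℂ (Set.range ![p, q]) = ⊤ := by
      rw [eq_top_iff]; intro x _; simpa [Set.pair_comm] using hc x
    have := finrank_range_le_card (R := ℂ) ![p, q]
    rw [Set.finrank, h1] at this
    simp at this
  have := det_of_LI (LI3 hli hr)
  refine ⟨q ⨯₃ r, ?_, ?_⟩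
  · rw [dotProduct_comm]; simp
  · rw [dotProduct_comm, triple_product_eq_det]; exact this

theorem conic_line {F : MvPolynomial (Fin 3) ℂ} (hF : F.IsHomogeneous 2) (p q : Fin 3 → ℂ) (s t : ℂ) :
    eval (s • p + t • q) F = s ^ 2 * eval p F + t ^ 2 * eval q F +
      s * t * (eval (p + q) F - eval p F - eval q F) := by
  simp only [eval_eq']
  simp only [← Finset.sum_sub_distrib, Finset.mul_sum, ← Finset.sum_add_distrib]
  apply Finset.sum_congr rfl
  intro d hd
  have h := hF (mem_support_iff.1 hd)
  have h2 : d 0 + d 1 + d 2 = 2 := by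
    refine Eq.trans ?_ h
    simp [Finsupp.weight_apply, Finsupp.sum_fintype, Fin.sum_univ_three]
  simp only [Fin.prod_univ_three, Pi.add_apply, Pi.smul_apply, smul_eq_mul]
  generalize d 0 = a at *
  generalize d 1 = b at *
  generalize d 2 = c at *
  have ha : a ≤ 2 := by omega
  have hb : b ≤ 2 := by omega
  obtain rfl : c = 2 - a - b := by omega
  interval_cases a <;> interval_cases b <;> first | omega | (simp; ring)

theorem scale_hom {F : MvPolynomial (Fin 3) ℂ} {n : ℕ} (hF : F.IsHomogeneous n) (c : ℂ) (w : Fin 3 → ℂ) :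
    eval (c • w) F = c ^ n * eval w F := by
  simp only [eval_eq', Finset.mul_sum]
  apply Finset.sum_congr rfl
  intro d hd
  have h := hF (mem_support_iff.1 hd)
  have h2 : ∑ i, d i = n := by
    rw [← h]; simp [Finsupp.weight_apply, Finsupp.sum_fintype]
  simp only [Pi.smul_apply, smul_eq_mul, mul_pow, Finset.prod_mul_distrib, Finset.prod_pow_eq_pow_sum, h2]
  ring

/-- restriction to a line -/
noncomputable def rline (A : MvPolynomial (Fin 3) ℂ) (u w : Fin 3 → ℂ) : Polynomial ℂ :=
  aeval (fun i => Polynomial.C (u i) + Polynomial.X * Polynomial.C (w i)) A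

theorem rline_eval (A : MvPolynomial (Fin 3) ℂ) (u w : Fin 3 → ℂ) (t : ℂ) :
    (rline A u w).eval t = eval (u + t • w) A := by
  unfold rline
  rw [← Polynomial.coe_aeval_eq_eval, ← AlgHom.comp_apply, comp_aeval, MvPolynomial.aeval_eq_eval]
  congr 2
  ext i
  simp
  ring

theorem rline_deg {A : MvPolynomial (Fin 3) ℂ} {n : ℕ} (hA : A.IsHomogeneous n) (u w : Fin 3 → ℂ) :
    (rline A u w).natDegree ≤ n := by
  have := aeval_natDegree_le A hA.totalDegree_le (fun i => Polynomial.C (u i) + Polynomial.X * Polynomial.C (w i)) (n := 1) (by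
    intro i; compute_degree)
  simpa [rline] using this

theorem rline_coeff {A : MvPolynomial (Fin 3) ℂ} {n : ℕ} (hA : A.IsHomogeneous n) (u w : Fin 3 → ℂ) :
    (rline A u w).coeff n = eval w A := by
  have key : Polynomial.reflect n (rline A u w) = rline A w u := by
    apply Polynomial.eq_of_infinite_eval_eq
    apply Set.Infinite.mono (s := {0}ᶜ)
    · intro x hx
      have hx : x ≠ 0 := hx
      let _ : Invertible (x⁻¹) := invertibleOfNonzero (inv_ne_zero hx)
      have := Polynomial.eval₂_reflect_mul_pow (RingHom.id ℂ) (x⁻¹) n _ (rline_deg hA u w)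
      simp only [invOf_eq_inv, inv_inv] at this
      change Polynomial.eval x _ * _ = Polynomial.eval _ _ at this
      have h2 : w + x • u = x • (u + x⁻¹ • w) := by
        rw [smul_add, smul_smul, mul_inv_cancel₀ hx, one_smul, add_comm]
      change Polynomial.eval x _ = Polynomial.eval x _
      rw [rline_eval, h2, scale_hom hA, ← rline_eval, ← this]
      rw [mul_comm (x ^ n), mul_assoc, ← mul_pow, inv_mul_cancel₀ hx, one_pow, mul_one]
    · exact Set.Finite.infinite_compl (Set.finite_singleton 0)
  have := congrArg (Polynomial.eval 0) key
  rw [rline_eval, ← Polynomial.coeff_zero_eq_eval_zero, Polynomial.coeff_reflect] at this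
  simpa using this

/-- A form of positive degree has a zero on each projective line. -/
theorem root_on_line {A : MvPolynomial (Fin 3) ℂ} {n : ℕ} (hn : 0 < n) (hA : A.IsHomogeneous n)
    (u w : Fin 3 → ℂ) (hli : LinearIndependent ℂ ![u, w]) :
    ∃ s t : ℂ, s • u + t • w ≠ 0 ∧ eval (s • u + t • w) A = 0 := by
  by_cases hw : eval w A = 0
  · refine ⟨0, 1, ?_, by simpa using hw⟩
    have := hli.ne_zero 1
    simpa using this
  · have hc := rline_coeff hA u w
    have hd : (rline A u w).degree ≠ 0 := by
      intro h
      have h5 : (rline A u w).natDegree = 0 := Polynomial.natDegree_eq_of_degree_eq_some h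
      apply hw
      rw [← hc, Polynomial.coeff_eq_zero_of_natDegree_lt]
      omega
    obtain ⟨t, ht⟩ := IsAlgClosed.exists_root _ hd
    refine ⟨1, t, ?_, ?_⟩
    · intro h
      have := LinearIndependent.pair_iff.1 hli _ _ h
      simp at this
    · rw [Polynomial.IsRoot, rline_eval] at ht
      simpa using ht

theorem finrank_hom (n : ℕ) :
    Module.finrank ℂ (homogeneousSubmodule (Fin 3) ℂ n) = (n + 2).choose 2 := by
  rw [homogeneousSubmodule_eq_finsupp_supported]
  have e := AddMonoidAlgebra.supportedEquivFinsupp (S := ℂ) (R := ℂ) {d : Fin 3 →₀ ℕ | d.degree = n}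
  have hs : {d : Fin 3 →₀ ℕ | d.degree = n} = ↑(Finset.finsuppAntidiag (Finset.univ : Finset (Fin 3)) n) := by
    ext d; simp [Finsupp.degree_eq_sum]
  have h1 := e.finrank_eq
  refine h1.trans ?_
  rw [hs]
  rw [Module.finrank_finsupp_self]
  simp only [Finset.coe_sort_coe, Fintype.card_coe]
  rw [Finset.card_finsuppAntidiag_nat_eq_choose]
  simp
  rw [add_comm 2 n, ← Nat.choose_symm (by omega)]
  simp

instance (n : ℕ) : FiniteDimensional ℂ (homogeneousSubmodule (Fin 3) ℂ n) := 
  Module.Finite.iff_fg.2 (homogeneousSubmodule_fg _ _ n)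

/-- Evaluation of forms of degree `n` at a family of vectors. -/
noncomputable def evH (n : ℕ) {ι : Type} (v : ι → Fin 3 → ℂ) :
    homogeneousSubmodule (Fin 3) ℂ n →ₗ[ℂ] (ι → ℂ) :=
  LinearMap.pi fun i => (aeval (R := ℂ) (v i)).toLinearMap ∘ₗ Submodule.subtype _

theorem evH_apply (n : ℕ) {ι : Type} (v : ι → Fin 3 → ℂ) (f : homogeneousSubmodule (Fin 3) ℂ n) (i : ι) :
    evH n v f i = eval (v i) f.1 := by
  simp [evH, MvPolynomial.aeval_eq_eval]

theorem surj_of_sep {ι W : Type} [Fintype ι] [AddCommGroup W] [Module ℂ W]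
    (E : W →ₗ[ℂ] (ι → ℂ)) (h : ∀ i, ∃ x, E x i ≠ 0 ∧ ∀ j, j ≠ i → E x j = 0) :
    Function.Surjective E := by
  classical
  choose x hx hx0 using h
  intro y
  refine ⟨∑ i, (y i / E (x i) i) • x i, ?_⟩
  ext j
  simp only [map_sum, map_smul, Finset.sum_apply, Pi.smul_apply, smul_eq_mul]
  rw [Finset.sum_eq_single j]
  · field_simp [hx j]
  · intro i _ hij
    rw [hx0 i j hij.symm, mul_zero]
  · simp

theorem ker_ext (L : Module.Dual ℂ (Fin 3 → ℂ)) (hL : L ≠ 0) (w : Fin 3 → ℂ) :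
    ∃ u, L u = 0 ∧ u ∉ Submodule.span ℂ {w} := by
  by_contra! hc
  have h1 : L.ker ≤ Submodule.span ℂ {w} := fun u hu => hc u hu
  have h2 := Submodule.finrank_mono h1
  have h3 := Module.Dual.finrank_ker_add_one_of_ne_zero hL
  have h4 := finrank_span_le_card (R := ℂ) ({w} : Set (Fin 3 → ℂ))
  simp at h3 h4
  omega

theorem LI2_of_notMem {u w : Fin 3 → ℂ} (hw : w ≠ 0) (h : u ∉ Submodule.span ℂ {w}) :
    LinearIndependent ℂ ![w, u] := by
  rw [LinearIndependent.pair_iff' hw]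
  intro a ha
  exact h (Submodule.mem_span_singleton.2 ⟨a, ha⟩)

theorem ker_ext2 (L : Module.Dual ℂ (Fin 3 → ℂ)) (hL : L ≠ 0) :
    ∃ u w, L u = 0 ∧ L w = 0 ∧ LinearIndependent ℂ ![u, w] := by
  obtain ⟨u, hu, hu0⟩ := ker_ext L hL 0
  have hu1 : u ≠ 0 := by
    rintro rfl; exact hu0 (Submodule.zero_mem _)
  obtain ⟨w, hw, hw0⟩ := ker_ext L hL u
  exact ⟨u, w, hu, hw, LI2_of_notMem hu1 hw0⟩

structure Cfg (F₁ F₂ G₁ G₂ : MvPolynomial (Fin 3) ℂ) (v : Fin 16 → (Fin 3 → ℂ)) : Prop where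
  hF₁0 : F₁ ≠ 0
  hF₂0 : F₂ ≠ 0
  hG₁0 : G₁ ≠ 0
  hG₂0 : G₂ ≠ 0
  hF₁ : F₁.IsHomogeneous 2
  hF₂ : F₂.IsHomogeneous 2
  hG₁ : G₁.IsHomogeneous 2
  hG₂ : G₂.IsHomogeneous 2
  hv : ∀ i, v i ≠ 0
  hdist : ∀ i j : Fin 16, i ≠ j → ¬ ProjEq (v i) (v j)
  hmeet : ∀ w : Fin 3 → ℂ, w ≠ 0 →
      ((eval w (F₁ * F₂) = 0 ∧ eval w (G₁ * G₂) = 0) ↔ ∃ i, ProjEq (v i) w)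

namespace Cfg

variable {F₁ F₂ G₁ G₂ : MvPolynomial (Fin 3) ℂ} {v : Fin 16 → (Fin 3 → ℂ)}

theorem swapF (h : Cfg F₁ F₂ G₁ G₂ v) : Cfg F₂ F₁ G₁ G₂ v :=
  ⟨h.hF₂0, h.hF₁0, h.hG₁0, h.hG₂0, h.hF₂, h.hF₁, h.hG₁, h.hG₂, h.hv, h.hdist, by
    rw [mul_comm]; exact h.hmeet⟩

theorem swapG (h : Cfg F₁ F₂ G₁ G₂ v) : Cfg F₁ F₂ G₂ G₁ v :=
  ⟨h.hF₁0, h.hF₂0, h.hG₂0, h.hG₁0, h.hF₁, h.hF₂, h.hG₂, h.hG₁, h.hv, h.hdist, by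
    rw [mul_comm G₂]; exact h.hmeet⟩

theorem swapFG (h : Cfg F₁ F₂ G₁ G₂ v) : Cfg G₁ G₂ F₁ F₂ v :=
  ⟨h.hG₁0, h.hG₂0, h.hF₁0, h.hF₂0, h.hG₁, h.hG₂, h.hF₁, h.hF₂, h.hv, h.hdist, fun w hw => by
    rw [and_comm]; exact h.hmeet w hw⟩

theorem no_zero_ker (h : Cfg F₁ F₂ G₁ G₂ v) {L : Module.Dual ℂ (Fin 3 → ℂ)}
    (hL : ∀ i, L (v i) ≠ 0) {w : Fin 3 → ℂ} (hw : w ≠ 0) (hLw : L w = 0)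
    (hA : eval w (F₁ * F₂) = 0) (hB : eval w (G₁ * G₂) = 0) : False := by
  obtain ⟨i, c, hc, rfl⟩ := (h.hmeet w hw).1 ⟨hA, hB⟩
  rw [map_smul, smul_eq_mul] at hLw
  exact (mul_ne_zero hc (hL i)) hLw

theorem no_common (h : Cfg F₁ F₂ G₁ G₂ v) {D : MvPolynomial (Fin 3) ℂ} {n : ℕ} (hn : 0 < n)
    (hD : D.IsHomogeneous n)
    (hz : ∀ w, eval w D = 0 → eval w (F₁ * F₂) = 0 ∧ eval w (G₁ * G₂) = 0) : False := by
  obtain ⟨L, hL⟩ := Module.exists_dual_forall_apply_ne_zero (K := ℂ) v h.hv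
  have hL0 : L ≠ 0 := by
    rintro rfl; exact hL 0 rfl
  obtain ⟨u, w, hu, hw, hli⟩ := ker_ext2 L hL0
  obtain ⟨s, t, h0, h1⟩ := root_on_line hn hD u w hli
  exact h.no_zero_ker hL h0 (by simp [hu, hw]) (hz _ h1).1 (hz _ h1).2

theorem coprime_half (h : Cfg F₁ F₂ G₁ G₂ v) (a b : Fin 3 → ℂ)
    (hab : F₁ * F₂ * linF a + G₁ * G₂ * linF b = 0) : b = 0 := by
  have hA : (F₁ * F₂).IsHomogeneous 4 := h.hF₁.mul h.hF₂
  have hB : (G₁ * G₂).IsHomogeneous 4 := h.hG₁.mul h.hG₂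
  obtain ⟨z, hz, hz0⟩ : ∃ z : Fin 3 → ℂ, b ⬝ᵥ z = 0 ∧ z ≠ 0 := by
    by_cases hb : b = 0
    · exact ⟨fun _ => 1, by simp [hb], fun hh => by simpa using congrFun hh 0⟩
    · obtain ⟨z, hz, hz0⟩ := ker_ext (dotProductBilin ℂ ℂ b) (by
        intro hh
        apply hb
        ext i
        have := congrArg (fun f => f (Pi.single i 1)) hh
        simpa using this) 0
      refine ⟨z, by simpa using hz, ?_⟩
      rintro rfl; exact hz0 (Submodule.zero_mem _)
  obtain ⟨L, hL'⟩ := Module.exists_dual_forall_apply_ne_zero (K := ℂ)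
    (fun i : Option (Fin 16) => i.elim z v) (by rintro (_ | i); exacts [hz0, h.hv i])
  have hL : ∀ i, L (v i) ≠ 0 := fun i => hL' (some i)
  have hLz : L z ≠ 0 := hL' none
  have hL0 : L ≠ 0 := by
    rintro rfl; exact hLz rfl
  obtain ⟨w, hw, hw0, hAw⟩ : ∃ w, L w = 0 ∧ w ≠ 0 ∧ eval w (F₁ * F₂) ≠ 0 := by
    by_contra! hc
    obtain ⟨u, w, hu, hw, hli⟩ := ker_ext2 L hL0
    obtain ⟨s, t, h0, h1⟩ := root_on_line (by norm_num) hB u w hli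
    have hk : L (s • u + t • w) = 0 := by simp [hu, hw]
    exact h.no_zero_ker hL h0 hk (hc _ hk h0) h1
  obtain ⟨u, hu, hu0⟩ := ker_ext L hL0 w
  have hli := LI2_of_notMem hw0 hu0
  have hcop : IsCoprime (rline (F₁ * F₂) u w) (rline (G₁ * G₂) u w) := by
    rw [Polynomial.isCoprime_iff_aeval_ne_zero_of_isAlgClosed ℂ ℂ]
    intro t
    by_contra! hc
    rw [Polynomial.coe_aeval_eq_eval, rline_eval, rline_eval] at hc
    refine h.no_zero_ker hL ?_ ?_ hc.1 hc.2
    · intro h0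
      have := LinearIndependent.pair_iff.1 hli t 1 (by rw [one_smul, add_comm]; exact h0)
      simp at this
    · simp [hu, hw]
  have hr : rline (F₁ * F₂) u w * rline (linF a) u w + rline (G₁ * G₂) u w * rline (linF b) u w = 0 := by
    have := congrArg (fun q => rline q u w) hab
    simpa only [rline, map_add, map_mul, map_zero] using this
  have hdvd : rline (F₁ * F₂) u w ∣ rline (linF b) u w := by
    apply hcop.dvd_of_dvd_mul_left
    rw [eq_neg_of_add_eq_zero_right hr]
    exact (dvd_mul_right _ _).neg_right
  have hdeg : 4 ≤ (rline (F₁ * F₂) u w).natDegree := by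
    apply Polynomial.le_natDegree_of_ne_zero
    rwa [rline_coeff hA]
  have hd1 := rline_deg (linF_hom b) u w
  have h0 := Polynomial.eq_zero_of_dvd_of_natDegree_lt hdvd (by omega)
  have hbw : b ⬝ᵥ w = 0 := by
    have := rline_coeff (linF_hom b) u w
    rw [h0, linF_eval] at this
    simpa using this.symm
  have hbu : b ⬝ᵥ u = 0 := by
    have := rline_eval (linF b) u w 0
    rw [h0, linF_eval] at this
    simpa using this.symm
  refine dot3 (det_of_LI (LI3 hli (r := z) ?_)) hbw hbu hz
  intro hm
  obtain ⟨α, β, rfl⟩ := Submodule.mem_span_pair.1 hm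
  apply hLz
  simp [hu, hw]

theorem noncoll (h : Cfg F₁ F₂ G₁ G₂ v) {i j k : Fin 16} (hij : i ≠ j) (hik : i ≠ k) (hjk : j ≠ k)
    (Fi : eval (v i) F₁ = 0) (Fj : eval (v j) F₁ = 0) (Fk : eval (v k) F₁ = 0)
    (Gi : eval (v i) G₁ = 0) (Gj : eval (v j) G₁ = 0) (Gk : eval (v k) G₁ = 0) :
    Matrix.det ![v i, v j, v k] ≠ 0 := by
  have hli := pairLI (h.hv i) (h.hv j) (h.hdist i j hij)
  apply det_of_LI
  apply LI3 hli
  intro hm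
  obtain ⟨α, β, hαβ⟩ := Submodule.mem_span_pair.1 hm
  have hα : α ≠ 0 := by
    rintro rfl
    refine h.hdist j k hjk ⟨β, ?_, by simpa using hαβ.symm⟩
    rintro rfl
    exact h.hv k (by simpa using hαβ.symm)
  have hβ : β ≠ 0 := by
    rintro rfl
    refine h.hdist i k hik ⟨α, hα, by simpa using hαβ.symm⟩
  obtain ⟨r, hr⟩ : ∃ r, r ∉ Submodule.span ℂ {v i, v j} := by
    by_contra! hc
    have h1 : Submodule.span ℂ (Set.range ![v i, v j]) = ⊤ := by
      rw [eq_top_iff]; intro x _; simpa [Set.pair_comm] using hc x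
    have := finrank_range_le_card (R := ℂ) ![v i, v j]
    rw [Set.finrank, h1] at this
    simp at this
  have key : ∀ F : MvPolynomial (Fin 3) ℂ, F.IsHomogeneous 2 → eval (v i) F = 0 → eval (v j) F = 0 →
      eval (v k) F = 0 → ∀ w, eval w (linF (v i ⨯₃ v j)) = 0 → eval w F = 0 := by
    intro F hF h1 h2 h3 w hw
    rw [← hαβ, conic_line hF, h1, h2] at h3
    have h4 : eval (v i + v j) F = 0 := by simpa [hα, hβ] using h3
    have hws : w ∈ Submodule.span ℂ {v i, v j} := by
      by_contra hws
      apply det_of_LI (LI3 hli hws)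
      rw [linF_eval] at hw
      rw [← triple_product_eq_det, triple_product_permutation, triple_product_permutation, dotProduct_comm]
      exact hw
    obtain ⟨s, t, rfl⟩ := Submodule.mem_span_pair.1 hws
    rw [conic_line hF, h1, h2, h4]
    ring
  refine h.no_common one_pos (linF_hom (v i ⨯₃ v j)) fun w hw => ?_
  rw [map_mul, map_mul, key F₁ h.hF₁ Fi Fj Fk w hw, key G₁ h.hG₁ Gi Gj Gk w hw]
  simp

open Classical in
/-- the indices of the points on both conics -/
noncomputable def blk (F G : MvPolynomial (Fin 3) ℂ) (v : Fin 16 → (Fin 3 → ℂ)) : Finset (Fin 16) :=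
  Finset.univ.filter fun i => eval (v i) F = 0 ∧ eval (v i) G = 0

theorem mem_blk {F G : MvPolynomial (Fin 3) ℂ} {i : Fin 16} :
    i ∈ blk F G v ↔ eval (v i) F = 0 ∧ eval (v i) G = 0 := by
  simp [blk]

theorem noncoll' (h : Cfg F₁ F₂ G₁ G₂ v) {i j k : Fin 16} (hij : i ≠ j) (hik : i ≠ k) (hjk : j ≠ k)
    (hi : i ∈ blk F₁ G₁ v) (hj : j ∈ blk F₁ G₁ v) (hk : k ∈ blk F₁ G₁ v) :
    Matrix.det ![v i, v j, v k] ≠ 0 := by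
  rw [mem_blk] at hi hj hk
  exact h.noncoll hij hik hjk hi.1 hj.1 hk.1 hi.2 hj.2 hk.2

theorem cross_self_left (p q : Fin 3 → ℂ) : (p ⨯₃ q) ⬝ᵥ p = 0 := by
  rw [dotProduct_comm]; simp

theorem cross_self_right (p q : Fin 3 → ℂ) : (p ⨯₃ q) ⬝ᵥ q = 0 := by
  rw [dotProduct_comm]; simp

theorem cross_ne {p q r : Fin 3 → ℂ} (h : Matrix.det ![p, q, r] ≠ 0) : (q ⨯₃ r) ⬝ᵥ p ≠ 0 := by
  rw [dotProduct_comm, triple_product_eq_det]; exact h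

theorem card4 {s : Finset (Fin 16)} (h : s.card = 4) : ∃ a b c d, a ≠ b ∧ a ≠ c ∧ a ≠ d ∧ b ≠ c ∧ b ≠ d ∧
    c ≠ d ∧ s = {a, b, c, d} := by
  obtain ⟨a, t, hat, rfl, ht⟩ := Finset.card_eq_succ.1 h
  obtain ⟨b, c, d, hbc, hbd, hcd, rfl⟩ := Finset.card_eq_three.1 ht
  simp only [Finset.mem_insert, Finset.mem_singleton, not_or] at hat
  exact ⟨a, b, c, d, hat.1, hat.2.1, hat.2.2, hbc, hbd, hcd, rfl⟩

/-- each block contains four points around a given one -/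
theorem card4' {s : Finset (Fin 16)} {a : Fin 16} (ha : a ∈ s) (h : s.card = 4) :
    ∃ b c d, a ≠ b ∧ a ≠ c ∧ a ≠ d ∧ b ≠ c ∧ b ≠ d ∧
    c ≠ d ∧ s = {a, b, c, d} := by
  have ht : (s.erase a).card = 3 := by rw [Finset.card_erase_of_mem ha, h]
  obtain ⟨b, c, d, hbc, hbd, hcd, he⟩ := Finset.card_eq_three.1 ht
  have hat := Finset.notMem_erase a s
  rw [he] at hat
  simp only [Finset.mem_insert, Finset.mem_singleton, not_or] at hat
  refine ⟨b, c, d, hat.1, hat.2.1, hat.2.2, hbc, hbd, hcd, ?_⟩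
  rw [← Finset.insert_erase ha, he]

theorem blk_card_le (h : Cfg F₁ F₂ G₁ G₂ v) : (blk F₁ G₁ v).card ≤ 4 := by
  by_contra! hc
  obtain ⟨T, hT, hTc⟩ := Finset.exists_subset_card_eq (Nat.succ_le_of_lt hc)
  have hsurj : Function.Surjective (evH 2 (fun i : T => v i)) := by
    apply surj_of_sep
    rintro ⟨i, hi⟩
    have hTe : (T.erase i).card = 4 := by rw [Finset.card_erase_of_mem hi, hTc]
    obtain ⟨a, b, c, d, hab, hac, had, hbc, hbd, hcd, he⟩ := card4 hTe
    have hm : ∀ x ∈ ({a, b, c, d} : Finset (Fin 16)), i ≠ x ∧ x ∈ blk F₁ G₁ v := by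
      intro x hx
      rw [← he] at hx
      exact ⟨(Finset.ne_of_mem_erase hx).symm, hT (Finset.mem_of_mem_erase hx)⟩
    have ha := hm a (by simp)
    have hb := hm b (by simp)
    have hc := hm c (by simp)
    have hd := hm d (by simp)
    have h1 := cross_ne (h.noncoll' ha.1 hb.1 hab (hT hi) ha.2 hb.2)
    have h2 := cross_ne (h.noncoll' hc.1 hd.1 hcd (hT hi) hc.2 hd.2)
    refine ⟨⟨linF (v a ⨯₃ v b) * linF (v c ⨯₃ v d), (linF_hom _).mul (linF_hom _)⟩, ?_, ?_⟩
    · rw [evH_apply]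
      simp only [map_mul, linF_eval]
      exact mul_ne_zero h1 h2
    · rintro ⟨j, hj⟩ hji
      have : j ∈ T.erase i := Finset.mem_erase.2 ⟨by simpa using hji, hj⟩
      rw [he] at this
      rw [evH_apply]
      simp only [map_mul, linF_eval]
      simp only [Finset.mem_insert, Finset.mem_singleton] at this
      rcases this with rfl | rfl | rfl | rfl <;> simp [cross_self_left, cross_self_right]
  have h2 := LinearMap.finrank_range_add_finrank_ker (evH 2 (fun i : T => v i))
  rw [LinearMap.range_eq_top.2 hsurj, finrank_top, finrank_hom, show Nat.choose (2 + 2) 2 = 6 from rfl] at h2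
  simp [hTc] at h2
  have hker : Module.finrank ℂ (LinearMap.ker (evH 2 (fun i : T => v i))) = 1 := by omega
  have hFk : (⟨F₁, h.hF₁⟩ : homogeneousSubmodule (Fin 3) ℂ 2) ∈ LinearMap.ker (evH 2 (fun i : T => v i)) := by
    rw [LinearMap.mem_ker]
    ext ⟨i, hi⟩
    rw [evH_apply]
    exact (mem_blk.1 (hT hi)).1
  have hGk : (⟨G₁, h.hG₁⟩ : homogeneousSubmodule (Fin 3) ℂ 2) ∈ LinearMap.ker (evH 2 (fun i : T => v i)) := by
    rw [LinearMap.mem_ker]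
    ext ⟨i, hi⟩
    rw [evH_apply]
    exact (mem_blk.1 (hT hi)).2
  obtain ⟨c, hc⟩ := exists_smul_eq_of_finrank_eq_one hker 
    (x := (⟨_, hFk⟩ : LinearMap.ker (evH 2 (fun i : T => v i)))) (by
    intro h0
    apply h.hF₁0
    exact congrArg (fun z => z.1.1) h0) ⟨_, hGk⟩
  have hc' : c • F₁ = G₁ := by
    simpa using congrArg (fun z => z.1.1) hc
  refine h.no_common two_pos h.hF₁ fun w hw => ?_
  rw [map_mul, map_mul, ← hc', smul_eval, hw]
  simp

theorem cover (h : Cfg F₁ F₂ G₁ G₂ v) (i : Fin 16) :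
    i ∈ blk F₁ G₁ v ∪ blk F₁ G₂ v ∪ blk F₂ G₁ v ∪ blk F₂ G₂ v := by
  have := (h.hmeet (v i) (h.hv i)).2 ⟨i, 1, one_ne_zero, by simp⟩
  simp only [map_mul, mul_eq_zero] at this
  simp only [Finset.mem_union, mem_blk]
  tauto

theorem blk_card (h : Cfg F₁ F₂ G₁ G₂ v) : (blk F₁ G₁ v).card = 4 := by
  have h0 : blk F₁ G₁ v ∪ blk F₁ G₂ v ∪ blk F₂ G₁ v ∪ blk F₂ G₂ v = Finset.univ := by
    ext i; simp only [h.cover i, Finset.mem_univ]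
  have h1 := h.blk_card_le
  have h2 := h.swapG.blk_card_le
  have h3 := h.swapF.blk_card_le
  have h4 := h.swapF.swapG.blk_card_le
  have h5 := congrArg Finset.card h0
  simp only [Finset.card_univ, Fintype.card_fin] at h5
  have h6 := Finset.card_union_le (blk F₁ G₁ v ∪ blk F₁ G₂ v ∪ blk F₂ G₁ v) (blk F₂ G₂ v)
  have h7 := Finset.card_union_le (blk F₁ G₁ v ∪ blk F₁ G₂ v) (blk F₂ G₁ v)
  have h8 := Finset.card_union_le (blk F₁ G₁ v) (blk F₁ G₂ v)
  omega

theorem F₂_ne (h : Cfg F₁ F₂ G₁ G₂ v) {i : Fin 16} (hi : i ∈ blk F₁ G₁ v) : eval (v i) F₂ ≠ 0 := by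
  intro hF
  have hi2 : i ∈ blk F₂ G₁ v := mem_blk.2 ⟨hF, (mem_blk.1 hi).2⟩
  have h0 : blk F₁ G₁ v ∪ blk F₁ G₂ v ∪ (blk F₂ G₁ v).erase i ∪ blk F₂ G₂ v = Finset.univ := by
    ext j
    have := h.cover j
    simp only [Finset.mem_union, Finset.mem_erase, Finset.mem_univ, iff_true] at this ⊢
    by_cases hj : j = i
    · subst hj; tauto
    · tauto
  have h1 := h.blk_card_le
  have h2 := h.swapG.blk_card_le
  have h3 := h.swapF.blk_card_le
  have h4 := h.swapF.swapG.blk_card_le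
  have h5 := congrArg Finset.card h0
  simp only [Finset.card_univ, Fintype.card_fin] at h5
  have h6 := Finset.card_union_le (blk F₁ G₁ v ∪ blk F₁ G₂ v ∪ (blk F₂ G₁ v).erase i) (blk F₂ G₂ v)
  have h7 := Finset.card_union_le (blk F₁ G₁ v ∪ blk F₁ G₂ v) ((blk F₂ G₁ v).erase i)
  have h8 := Finset.card_union_le (blk F₁ G₁ v) (blk F₁ G₂ v)
  have h9 := Finset.card_erase_of_mem hi2
  omega

theorem blk_comm (F G : MvPolynomial (Fin 3) ℂ) : blk F G v = blk G F v := by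
  ext i; simp only [mem_blk, and_comm]

theorem G₂_ne (h : Cfg F₁ F₂ G₁ G₂ v) {i : Fin 16} (hi : i ∈ blk F₁ G₁ v) : eval (v i) G₂ ≠ 0 :=
  h.swapFG.F₂_ne (by rwa [blk_comm])

theorem lin_zero (h : Cfg F₁ F₂ G₁ G₂ v) {a : Fin 3 → ℂ} (ha : ∀ i ∈ blk F₁ G₁ v, a ⬝ᵥ v i = 0) : a = 0 := by
  obtain ⟨i, j, k, l, hij, hik, hil, hjk, hjl, hkl, he⟩ := card4 h.blk_card
  have hi : i ∈ blk F₁ G₁ v := by simp [he]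
  have hj : j ∈ blk F₁ G₁ v := by simp [he]
  have hk : k ∈ blk F₁ G₁ v := by simp [he]
  exact dot3 (h.noncoll' hij hik hjk hi hj hk) (ha i hi) (ha j hj) (ha k hk)

theorem sep_cubic (h : Cfg F₁ F₂ G₁ G₂ v) {i : Fin 16} (hi : i ∈ blk F₁ G₁ v) :
    ∃ c : MvPolynomial (Fin 3) ℂ, c.IsHomogeneous 3 ∧ eval (v i) c ≠ 0 ∧
      ∀ j ∈ blk F₁ G₁ v, j ≠ i → eval (v j) c = 0 := by
  obtain ⟨j, k, l, hij, hik, hil, hjk, hjl, hkl, he⟩ := card4' hi h.blk_card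
  obtain ⟨a, ha, ha'⟩ := sep (h.hv i) (h.hv j) (h.hdist _ _ hij)
  obtain ⟨b, hb, hb'⟩ := sep (h.hv i) (h.hv k) (h.hdist _ _ hik)
  obtain ⟨c, hc, hc'⟩ := sep (h.hv i) (h.hv l) (h.hdist _ _ hil)
  refine ⟨linF a * linF b * linF c, ((linF_hom a).mul (linF_hom b)).mul (linF_hom c), ?_, ?_⟩
  · simp only [map_mul, linF_eval]
    exact mul_ne_zero (mul_ne_zero ha' hb') hc'
  · intro x hx hxi
    rw [he] at hx
    simp only [Finset.mem_insert, Finset.mem_singleton] at hx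
    simp only [map_mul, linF_eval]
    rcases hx with rfl | rfl | rfl | rfl
    · exact absurd rfl hxi
    · simp [ha]
    · simp [hb]
    · simp [hc]

/-- the map `(a, b) ↦ A a + B b` with linear forms `a`, `b` -/
noncomputable def kos (n m : ℕ) (hnm : n + 1 = m) (A B : MvPolynomial (Fin 3) ℂ) (hA : A.IsHomogeneous n) (hB : B.IsHomogeneous n) :
    ((Fin 3 → ℂ) × (Fin 3 → ℂ)) →ₗ[ℂ] homogeneousSubmodule (Fin 3) ℂ m :=
  LinearMap.codRestrict _
    (LinearMap.coprod ((LinearMap.mulLeft ℂ A) ∘ₗ linF) ((LinearMap.mulLeft ℂ B) ∘ₗ linF))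
    (fun c => hnm ▸ (hA.mul (linF_hom c.1)).add (hB.mul (linF_hom c.2)))

theorem kos_apply (n m : ℕ) (hnm : n + 1 = m) (A B : MvPolynomial (Fin 3) ℂ) (hA : A.IsHomogeneous n) (hB : B.IsHomogeneous n)
    (c : (Fin 3 → ℂ) × (Fin 3 → ℂ)) : (kos n m hnm A B hA hB c).1 = A * linF c.1 + B * linF c.2 := rfl

theorem kos_range (n m : ℕ) (hnm : n + 1 = m) (A B : MvPolynomial (Fin 3) ℂ) (hA : A.IsHomogeneous n) (hB : B.IsHomogeneous n)
    (hA0 : A ≠ 0) (hi : ∀ a b, A * linF a + B * linF b = 0 → b = 0) :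
    Module.finrank ℂ (LinearMap.range (kos n m hnm A B hA hB)) = 6 := by
  rw [LinearMap.finrank_range_of_inj]
  · simp
  · rw [← LinearMap.ker_eq_bot, LinearMap.ker_eq_bot']
    rintro ⟨a, b⟩ hab
    have h1 := congrArg Subtype.val hab
    rw [kos_apply] at h1
    have hb := hi a b h1
    subst hb
    have ha : a = 0 := by
      by_contra ha
      have : A * linF a = 0 := by simpa using h1
      exact (mul_ne_zero hA0 (linF_ne ha)) this
    rw [ha]; rfl

theorem cubic_form (h : Cfg F₁ F₂ G₁ G₂ v) {c : MvPolynomial (Fin 3) ℂ} (hc : c.IsHomogeneous 3)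
    (hz : ∀ i ∈ blk F₁ G₁ v, eval (v i) c = 0) : ∃ a b, c = F₁ * linF a + G₁ * linF b := by
  have hr := kos_range 2 3 rfl F₁ G₁ h.hF₁ h.hG₁ h.hF₁0 (by
    intro a b hab
    apply h.swapG.lin_zero
    intro i hi
    have h1 := congrArg (eval (v i)) hab
    simp only [map_add, map_mul, (mem_blk.1 hi).1, linF_eval, map_zero, zero_mul, zero_add] at h1
    exact (mul_eq_zero.1 h1).resolve_left (h.swapG.G₂_ne hi))
  let E := evH 3 (fun i : blk F₁ G₁ v => v i)
  have hsurj : Function.Surjective E := by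
    apply surj_of_sep
    rintro ⟨i, hi⟩
    obtain ⟨c, hc, h1, h2⟩ := h.sep_cubic hi
    refine ⟨⟨c, hc⟩, ?_, ?_⟩
    · rw [evH_apply]; exact h1
    · rintro ⟨j, hj⟩ hji
      rw [evH_apply]; exact h2 j hj (by simpa using hji)
  have h2 := LinearMap.finrank_range_add_finrank_ker E
  rw [LinearMap.range_eq_top.2 hsurj, finrank_top, finrank_hom, show Nat.choose (3 + 2) 2 = 10 from rfl] at h2
  simp [h.blk_card] at h2
  have hle : LinearMap.range (kos 2 3 rfl F₁ G₁ h.hF₁ h.hG₁) ≤ LinearMap.ker E := by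
    rintro _ ⟨x, rfl⟩
    rw [LinearMap.mem_ker]
    ext ⟨i, hi⟩
    rw [evH_apply, kos_apply]
    simp [(mem_blk.1 hi).1, (mem_blk.1 hi).2]
  have heq := Submodule.eq_of_le_of_finrank_eq hle (by rw [hr]; omega)
  have hcE : (⟨c, hc⟩ : homogeneousSubmodule (Fin 3) ℂ 3) ∈ LinearMap.ker E := by
    rw [LinearMap.mem_ker]
    ext ⟨i, hi⟩
    rw [evH_apply]
    exact hz i hi
  rw [← heq] at hcE
  obtain ⟨x, hx⟩ := hcE
  exact ⟨x.1, x.2, by rw [← kos_apply 2 3 rfl F₁ G₁ h.hF₁ h.hG₁ x, hx]⟩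

theorem cubic_zero (h : Cfg F₁ F₂ G₁ G₂ v) {c : MvPolynomial (Fin 3) ℂ} (hc : c.IsHomogeneous 3)
    (hz : ∀ i, eval (v i) c = 0) : c = 0 := by
  obtain ⟨a, b, rfl⟩ := h.cubic_form hc (fun i _ => hz i)
  have hb : b = 0 := by
    apply h.swapG.lin_zero
    intro i hi
    have h1 := hz i
    simp only [map_add, map_mul, (mem_blk.1 hi).1, linF_eval, zero_mul, zero_add] at h1
    exact (mul_eq_zero.1 h1).resolve_left (h.swapG.G₂_ne hi)
  have ha : a = 0 := by
    apply h.swapF.lin_zero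
    intro i hi
    have h1 := hz i
    simp only [map_add, map_mul, (mem_blk.1 hi).2, linF_eval, zero_mul, add_zero] at h1
    exact (mul_eq_zero.1 h1).resolve_left (h.swapF.F₂_ne hi)
  simp [ha, hb]

theorem conic_zero (h : Cfg F₁ F₂ G₁ G₂ v) {c : MvPolynomial (Fin 3) ℂ} (hc : c.IsHomogeneous 2)
    (hz : ∀ i, eval (v i) c = 0) : c = 0 := by
  have := h.cubic_zero (hc.mul (isHomogeneous_X ℂ 0)) (by intro i; simp [hz i])
  simpa using this

theorem exists_rel (h : Cfg F₁ F₂ G₁ G₂ v) : ∃ l : Fin 16 → ℂ, l ≠ 0 ∧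
    ∀ q : MvPolynomial (Fin 3) ℂ, q.IsHomogeneous 5 → ∑ i, l i * eval (v i) q = 0 := by
  have hr := kos_range 4 5 rfl (F₁ * F₂) (G₁ * G₂) (h.hF₁.mul h.hF₂) (h.hG₁.mul h.hG₂)
    (mul_ne_zero h.hF₁0 h.hF₂0) h.coprime_half
  have hle : LinearMap.range (kos 4 5 rfl (F₁ * F₂) (G₁ * G₂) (h.hF₁.mul h.hF₂) (h.hG₁.mul h.hG₂)) ≤
      LinearMap.ker (evH 5 v) := by
    rintro _ ⟨x, rfl⟩
    rw [LinearMap.mem_ker]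
    ext i
    have := (h.hmeet (v i) (h.hv i)).2 ⟨i, 1, one_ne_zero, by simp⟩
    rw [evH_apply, kos_apply, map_add, map_mul, map_mul _ (G₁ * G₂), this.1, this.2]
    simp
  have h1 := Submodule.finrank_mono hle
  have h2 := LinearMap.finrank_range_add_finrank_ker (evH 5 v)
  rw [finrank_hom, show Nat.choose (5 + 2) 2 = 21 from rfl] at h2
  have hlt : LinearMap.range (evH 5 v) < ⊤ := by
    rw [lt_top_iff_ne_top]
    intro ht
    rw [ht, finrank_top] at h2
    simp at h2
    omega
  obtain ⟨f, hf0, hf⟩ := Submodule.exists_le_ker_of_lt_top _ hlt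
  have hfe : ∀ x : Fin 16 → ℂ, f x = ∑ i, f (Pi.single i 1) * x i := by
    intro x
    conv_lhs => rw [pi_eq_sum_univ' x]
    simp [mul_comm]
  refine ⟨fun i => f (Pi.single i 1), ?_, ?_⟩
  · intro h0
    apply hf0
    ext i
    simpa using congrFun h0 i
  · intro q hq
    have := hf ⟨⟨q, hq⟩, rfl⟩
    rw [LinearMap.mem_ker, hfe] at this
    simpa only [evH_apply] using this

/-- `l` is a relation among the values of quintics -/
def Rel (v : Fin 16 → Fin 3 → ℂ) (l : Fin 16 → ℂ) : Prop :=
  ∀ q : MvPolynomial (Fin 3) ℂ, q.IsHomogeneous 5 → ∑ i, l i * eval (v i) q = 0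

theorem rel_blk (h : Cfg F₁ F₂ G₁ G₂ v) {l : Fin 16 → ℂ} (hl : Rel v l) {i : Fin 16}
    (hi : i ∈ blk F₁ G₁ v) (hli : l i = 0) : ∀ j ∈ blk F₁ G₁ v, l j = 0 := by
  intro j hj
  by_cases hij : i = j
  · rw [← hij]; exact hli
  obtain ⟨a, b, c, hja, hjb, hjc, hab, hac, hbc, he⟩ := card4' hj h.blk_card
  obtain ⟨k, m, hkm, hk, hm, hjk, hjm, hall⟩ : ∃ k m, k ≠ m ∧ k ∈ blk F₁ G₁ v ∧ m ∈ blk F₁ G₁ v ∧ j ≠ k ∧ j ≠ m ∧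
      ∀ x ∈ blk F₁ G₁ v, x = j ∨ x = i ∨ x = k ∨ x = m := by
    have hi' := hi
    rw [he] at hi' ⊢
    simp only [Finset.mem_insert, Finset.mem_singleton] at hi' ⊢
    rcases hi' with rfl | rfl | rfl | rfl
    · exact absurd rfl hij
    · exact ⟨b, c, by tauto⟩
    · exact ⟨a, c, by tauto⟩
    · exact ⟨a, b, by tauto⟩
  have hd := cross_ne (h.noncoll' hjk hjm hkm hj hk hm)
  have h1 := hl (F₂ * G₂ * linF (v k ⨯₃ v m)) ((h.hF₂.mul h.hG₂).mul (linF_hom _))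
  rw [Finset.sum_eq_single j] at h1
  · simp only [map_mul, linF_eval] at h1
    exact (mul_eq_zero.1 h1).resolve_right (mul_ne_zero (mul_ne_zero (h.F₂_ne hj) (h.G₂_ne hj)) hd)
  · intro x _ hxj
    simp only [map_mul, linF_eval]
    by_cases hx : x ∈ blk F₁ G₁ v
    · rcases hall x hx with rfl | rfl | rfl | rfl
      · exact absurd rfl hxj
      · simp [hli]
      · simp [cross_self_left]
      · simp [cross_self_right]
    · have := h.cover x
      simp only [Finset.mem_union, hx, false_or] at this
      rcases this with (this | this) | this
      · simp [(mem_blk.1 this).2]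
      · simp [(mem_blk.1 this).1]
      · simp [(mem_blk.1 this).1]
  · simp

theorem rel_next (h : Cfg F₁ F₂ G₁ G₂ v) {l : Fin 16 → ℂ} (hl : Rel v l)
    (h0 : ∀ i ∈ blk F₁ G₁ v, l i = 0) : ∀ j ∈ blk F₁ G₂ v, l j = 0 := by
  intro j hj
  obtain ⟨c, hc, hcj, hc0⟩ := h.swapG.sep_cubic hj
  have h1 := hl (F₂ * c) (h.hF₂.mul hc)
  rw [Finset.sum_eq_single j] at h1
  · simp only [map_mul] at h1
    exact (mul_eq_zero.1 h1).resolve_right (mul_ne_zero (h.swapG.F₂_ne hj) hcj)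
  · intro x _ hxj
    simp only [map_mul]
    have := h.cover x
    simp only [Finset.mem_union] at this
    rcases this with ((this | this) | this) | this
    · simp [h0 x this]
    · simp [hc0 x this hxj]
    · simp [(mem_blk.1 this).1]
    · simp [(mem_blk.1 this).1]
  · simp

theorem rel_zero (h : Cfg F₁ F₂ G₁ G₂ v) {l : Fin 16 → ℂ} (hl : Rel v l) {i : Fin 16}
    (hi : i ∈ blk F₁ G₁ v) (hli : l i = 0) : l = 0 := by
  have h11 := h.rel_blk hl hi hli
  have h12 := h.rel_next hl h11
  have h21 := h.swapFG.rel_next hl (by rwa [blk_comm])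
  have h22 := h.swapG.swapFG.rel_next hl (by rwa [blk_comm])
  rw [blk_comm] at h21 h22
  ext j
  have := h.cover j
  simp only [Finset.mem_union] at this
  rcases this with ((this | this) | this) | this
  exacts [h11 j this, h12 j this, h21 j this, h22 j this]

theorem rel_ne (h : Cfg F₁ F₂ G₁ G₂ v) {l : Fin 16 → ℂ} (hl : Rel v l) (hl0 : l ≠ 0) (i : Fin 16) :
    l i ≠ 0 := by
  intro hli
  have := h.cover i
  simp only [Finset.mem_union] at this
  rcases this with ((this | this) | this) | this
  · exact hl0 (h.rel_zero hl this hli)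
  · exact hl0 (h.swapG.rel_zero hl this hli)
  · exact hl0 (h.swapF.rel_zero hl this hli)
  · exact hl0 (h.swapF.swapG.rel_zero hl this hli)

/-- One direction of duality between degrees `m` and `n`, `m + n = 5`. -/
theorem dual_step {l : Fin 16 → ℂ} (hl : Rel v l) (hl0 : ∀ i, l i ≠ 0) {m n : ℕ} (hmn : m + n = 5)
    (S : Finset (Fin 16)) (hS : Sᶜ.card = (n + 2).choose 2)
    (f : MvPolynomial (Fin 3) ℂ) (hf : f.IsHomogeneous m) (hfS : ∀ i ∈ S, eval (v i) f = 0)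
    (hfne : ∃ i, eval (v i) f ≠ 0) :
    ∃ g : MvPolynomial (Fin 3) ℂ, g ≠ 0 ∧ g.IsHomogeneous n ∧ ∀ i ∉ S, eval (v i) g = 0 := by
  by_contra! hc
  let E := evH n (fun i : (Sᶜ : Finset (Fin 16)) => v i)
  have hinj : Function.Injective E := by
    rw [← LinearMap.ker_eq_bot, LinearMap.ker_eq_bot']
    rintro ⟨g, hg⟩ hg0
    by_contra hne
    obtain ⟨i, hi, hi0⟩ := hc g (by simpa using hne) hg
    apply hi0
    have := congrFun hg0 ⟨i, by simpa using hi⟩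
    rw [evH_apply] at this
    exact this
  have hsurj : Function.Surjective E := by
    rw [← LinearMap.injective_iff_surjective_of_finrank_eq_finrank]
    · exact hinj
    · rw [finrank_hom]; simp only [Module.finrank_fintype_fun_eq_card, Fintype.card_coe, hS]
  obtain ⟨i, hi⟩ := hfne
  have hiS : i ∉ S := fun h => hi (hfS i h)
  classical
  obtain ⟨⟨g, hg⟩, hgE⟩ := hsurj (Pi.single ⟨i, by simpa using hiS⟩ 1)
  have hgv : ∀ j (hj : j ∉ S), eval (v j) g = if j = i then 1 else 0 := by
    intro j hj
    have := congrFun hgE ⟨j, by simpa using hj⟩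
    rw [evH_apply] at this
    rw [Pi.single_apply] at this
    simpa using this
  have h1 := hl (f * g) (by rw [← hmn]; exact hf.mul hg)
  rw [Finset.sum_eq_single i] at h1
  · rw [map_mul, hgv i hiS] at h1
    simp [hl0 i, hi] at h1
  · intro j _ hji
    by_cases hj : j ∈ S
    · simp [hfS j hj]
    · simp [hgv j hj, hji]
  · simp

end Cfg

/-- **A Cayley–Bacharach consequence.** Let `F₁, F₂, G₁, G₂` be nonzero homogeneous
degree-2 polynomials such that the quartic curves `F₁·F₂ = 0` and `G₁·G₂ = 0` meet in
exactly 16 pairwise distinct points of `ℙ²(ℂ)`.  Split the 16 points into a set of 10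
and the remaining 6.  Then a cubic passes through the 10 points iff a conic passes
through the remaining 6. -/
theorem cubic_through_ten_iff_conic_through_six
    (F₁ F₂ G₁ G₂ : MvPolynomial (Fin 3) ℂ)
    (hF₁0 : F₁ ≠ 0) (hF₂0 : F₂ ≠ 0) (hG₁0 : G₁ ≠ 0) (hG₂0 : G₂ ≠ 0)
    (hF₁ : F₁.IsHomogeneous 2) (hF₂ : F₂.IsHomogeneous 2)
    (hG₁ : G₁.IsHomogeneous 2) (hG₂ : G₂.IsHomogeneous 2)
    (v : Fin 16 → (Fin 3 → ℂ)) (hv : ∀ i, v i ≠ 0)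
    (hdist : ∀ i j : Fin 16, i ≠ j → ¬ ProjEq (v i) (v j))
    (hmeet : ∀ w : Fin 3 → ℂ, w ≠ 0 →
      ((eval w (F₁ * F₂) = 0 ∧ eval w (G₁ * G₂) = 0) ↔ ∃ i, ProjEq (v i) w))
    (S : Finset (Fin 16)) (hS : S.card = 10) :
    (∃ f : MvPolynomial (Fin 3) ℂ, f ≠ 0 ∧ f.IsHomogeneous 3 ∧
      ∀ i ∈ S, eval (v i) f = 0) ↔
    (∃ g : MvPolynomial (Fin 3) ℂ, g ≠ 0 ∧ g.IsHomogeneous 2 ∧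
      ∀ i ∉ S, eval (v i) g = 0) := by
  have h : Cfg F₁ F₂ G₁ G₂ v := ⟨hF₁0, hF₂0, hG₁0, hG₂0, hF₁, hF₂, hG₁, hG₂, hv, hdist, hmeet⟩
  obtain ⟨l, hl0, hl⟩ := h.exists_rel
  have hlne := h.rel_ne hl hl0
  constructor
  · rintro ⟨f, hf0, hf, hfS⟩
    refine Cfg.dual_step hl hlne (m := 3) (n := 2) rfl S ?_ f hf hfS ?_
    · rw [Finset.card_compl, hS]; rfl
    · by_contra! hc
      exact hf0 (h.cubic_zero hf hc)
  · rintro ⟨f, hf0, hf, hfS⟩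
    obtain ⟨g, hg0, hg, hgS⟩ := Cfg.dual_step hl hlne (m := 2) (n := 3) rfl Sᶜ
      (by rw [compl_compl, hS]; rfl) f hf (fun i hi => hfS i (by simpa using hi)) (by
        by_contra! hc
        exact hf0 (h.conic_zero hf hc))
    exact ⟨g, hg0, hg, fun i hi => hgS i (by simpa using hi)⟩
end

section
/- Let A, B, C be three affinely independent points of ℝ². Let a₁ = B + α₁(C−B) and a₂ = B + α₂(C−B) be points on line BC, let b₁ = C + β₁(A−C) and b₂ = C + β₂(A−C) be points on line CA, and let c₁ = A + γ₁(B−A) and c₂ = A + γ₂(B−A) be points on line AB, where none of the parameters α₁, α₂, β₁, β₂, γ₁, γ₂ equals 0 or 1 (so none of the six points is a vertex) and the six points a₁, a₂, b₁, b₂, c₁, c₂ are pairwise distinct. Then the six points lie on a conic (i.e., there is a nonzero polynomial in two variables of degree at most 2 vanishing at all six points) if and only if (α₁/(1−α₁))·(α₂/(1−α₂))·(β₁/(1−β₁))·(β₂/(1−β₂))·(γ₁/(1−γ₁))·(γ₂/(1−γ₂)) = 1. (This is Carnot's Theorem: the left-hand side is the product of the signed ratios |Ba₁|/|a₁C|,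 |Ba₂|/|a₂C|, |Cb₁|/|b₁A|, |Cb₂|/|b₂A|, |Ac₁|/|c₁B|, |Ac₂|/|c₂B|.) -/
open MvPolynomial

/-- A function on the plane given by a polynomial of degree at most two. -/
def IsQuadFun (F : (Fin 2 → ℝ) → ℝ) : Prop :=
  ∃ a b c d e f : ℝ, ∀ x : Fin 2 → ℝ,
    F x = a + b * x 0 + c * x 1 + d * (x 0) ^ 2 + e * (x 0 * x 1) + f * (x 1) ^ 2

lemma isQuadFun_sum (s : Finset (Fin 2 →₀ ℕ)) (G : (Fin 2 →₀ ℕ) → (Fin 2 → ℝ) → ℝ)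
    (h : ∀ m ∈ s, IsQuadFun (G m)) : IsQuadFun (fun x => ∑ m ∈ s, G m x) := by
  classical
  induction s using Finset.induction_on with
  | empty => exact ⟨0, 0, 0, 0, 0, 0, fun x => by simp⟩
  | insert m s hm ih =>
    obtain ⟨a, b, c, d, e, f, h1⟩ := h m (Finset.mem_insert_self _ _)
    obtain ⟨a', b', c', d', e', f', h2⟩ := ih (fun k hk => h k (Finset.mem_insert_of_mem hk))
    refine ⟨a + a', b + b', c + c', d + d', e + e', f + f', fun x => ?_⟩
    have h3 := h2 x
    simp only at h3
    simp only [Finset.sum_insert hm]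
    rw [h1 x, h3]
    ring

lemma isQuadFun_eval (p : MvPolynomial (Fin 2) ℝ) (hp : p.totalDegree ≤ 2) :
    IsQuadFun (fun x => eval x p) := by
  have : (fun x => eval x p) = fun x => ∑ m ∈ p.support, p.coeff m * (x 0 ^ m 0 * x 1 ^ m 1) := by
    funext x
    rw [eval_eq']
    simp [Fin.prod_univ_two]
  rw [this]
  apply isQuadFun_sum p.support (fun m x => p.coeff m * (x 0 ^ m 0 * x 1 ^ m 1))
  intro m hm
  have h1 := (le_totalDegree hm).trans hp
  rw [Finsupp.sum_fintype _ _ (fun _ => rfl), Fin.sum_univ_two] at h1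
  generalize p.coeff m = k
  generalize m 0 = i at *
  generalize m 1 = j at *
  have hi : i ≤ 2 := by omega
  have hj : j ≤ 2 := by omega
  interval_cases i <;> interval_cases j <;> try omega
  · exact ⟨k, 0, 0, 0, 0, 0, fun x => by ring⟩
  · exact ⟨0, 0, k, 0, 0, 0, fun x => by ring⟩
  · exact ⟨0, 0, 0, 0, 0, k, fun x => by ring⟩
  · exact ⟨0, k, 0, 0, 0, 0, fun x => by ring⟩
  · exact ⟨0, 0, 0, 0, k, 0, fun x => by ring⟩
  · exact ⟨0, 0, 0, k, 0, 0, fun x => by ring⟩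

/-- A quadratic function in barycentric coordinates. -/
lemma IsQuadFun.bary {F : (Fin 2 → ℝ) → ℝ} (hF : IsQuadFun F) (A B C : Fin 2 → ℝ) :
    ∃ p q r d e g : ℝ, ∀ (u v w : ℝ) (x : Fin 2 → ℝ), u + v + w = 1 →
      x 0 = u * A 0 + v * B 0 + w * C 0 → x 1 = u * A 1 + v * B 1 + w * C 1 →
      F x = p * u ^ 2 + q * v ^ 2 + r * w ^ 2 + d * (v * w) + e * (w * u) + g * (u * v) := by
  obtain ⟨a, b, c, d, e, f, h⟩ := hF
  let Q : (Fin 2 → ℝ) → (Fin 2 → ℝ) → ℝ := fun X Y =>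
    2 * a + b * (X 0 + Y 0) + c * (X 1 + Y 1) + 2 * d * (X 0 * Y 0)
      + e * (X 0 * Y 1 + X 1 * Y 0) + 2 * f * (X 1 * Y 1)
  refine ⟨Q A A / 2, Q B B / 2, Q C C / 2, Q B C, Q C A, Q A B, fun u v w x hs h0 h1 => ?_⟩
  rw [h, h0, h1]
  obtain rfl : w = 1 - u - v := by linarith
  simp only [Q]
  ring

/-- Twice the signed area of a triangle. -/
def area (A B C : Fin 2 → ℝ) : ℝ :=
  (B 0 - A 0) * (C 1 - A 1) - (B 1 - A 1) * (C 0 - A 0)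

lemma area_ne_zero {A B C : Fin 2 → ℝ} (h : AffineIndependent ℝ ![A, B, C]) :
    area A B C ≠ 0 := by
  intro h0
  rw [affineIndependent_iff] at h
  unfold area at h0
  have key : ∀ s t : ℝ, s * (B 0 - A 0) + t * (C 0 - A 0) = 0 →
      s * (B 1 - A 1) + t * (C 1 - A 1) = 0 → s = 0 ∧ t = 0 := by
    intro s t h1 h2
    have := h Finset.univ ![-s - t, s, t] (by simp [Fin.sum_univ_three]; ring)
      (by
        simp only [Fin.sum_univ_three]
        funext i
        fin_cases i
        · simp; linarith
        · simp; linarith)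
    exact ⟨by simpa using this 1 (Finset.mem_univ _), by simpa using this 2 (Finset.mem_univ _)⟩
  have k1 := key (C 1 - A 1) (-(B 1 - A 1)) (by linarith) (by ring)
  have k2 := key (C 0 - A 0) (-(B 0 - A 0)) (by ring) (by linarith)
  have k3 := key 1 0 (by linarith [k2.2]) (by linarith [k1.2])
  exact one_ne_zero k3.1

/-- If the quadratic `q (1-t)^2 + r t^2 + d t (1-t)` has distinct roots `s`, `t`. -/
lemma side {q r d s t : ℝ} (hne : s ≠ t)
    (h1 : q * (1 - s) ^ 2 + r * s ^ 2 + d * ((1 - s) * s) = 0)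
    (h2 : q * (1 - t) ^ 2 + r * t ^ 2 + d * ((1 - t) * t) = 0) :
    q * ((1 - s) * (1 - t)) = r * (s * t) := by
  have : (s - t) * (q * ((1 - s) * (1 - t)) - r * (s * t)) = 0 := by
    linear_combination -(t * (1 - t)) * h1 + (s * (1 - s)) * h2
  rcases mul_eq_zero.1 this with h | h
  · exact absurd (sub_eq_zero.1 h) hne
  · linarith

lemma side_conv {q r s t : ℝ} (hs : s ≠ 0) (ht : t ≠ 0)
    (h : q * ((1 - s) * (1 - t)) = r * (s * t)) :
    ∃ d, q * (1 - s) ^ 2 + r * s ^ 2 + d * ((1 - s) * s) = 0 ∧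
      q * (1 - t) ^ 2 + r * t ^ 2 + d * ((1 - t) * t) = 0 := by
  have hr : r = q * ((1 - s) * (1 - t)) / (s * t) := by field_simp; linarith
  refine ⟨2 * q - q * (s + t) / (s * t), ?_, ?_⟩
  · rw [hr]; field_simp; ring
  · rw [hr]; field_simp; ring

lemma ratio_iff {α₁ α₂ β₁ β₂ γ₁ γ₂ : ℝ}
    (hα₁' : α₁ ≠ 1) (hα₂' : α₂ ≠ 1) (hβ₁' : β₁ ≠ 1) (hβ₂' : β₂ ≠ 1)
    (hγ₁' : γ₁ ≠ 1) (hγ₂' : γ₂ ≠ 1) :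
    (α₁ / (1 - α₁)) * (α₂ / (1 - α₂)) * (β₁ / (1 - β₁)) * (β₂ / (1 - β₂)) *
      (γ₁ / (1 - γ₁)) * (γ₂ / (1 - γ₂)) = 1 ↔
    (α₁ * α₂) * (β₁ * β₂) * (γ₁ * γ₂) =
      ((1 - α₁) * (1 - α₂)) * ((1 - β₁) * (1 - β₂)) * ((1 - γ₁) * (1 - γ₂)) := by
  have e1 := sub_ne_zero.2 hα₁'.symm
  have e2 := sub_ne_zero.2 hα₂'.symm
  have e3 := sub_ne_zero.2 hβ₁'.symm
  have e4 := sub_ne_zero.2 hβ₂'.symm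
  have e5 := sub_ne_zero.2 hγ₁'.symm
  have e6 := sub_ne_zero.2 hγ₂'.symm
  simp only [div_mul_div_comm]
  rw [div_eq_one_iff_eq (by positivity)]
  constructor <;> intro h <;> linarith

/-- The polynomial `x ↦ area x B C`. -/
noncomputable def areaPoly (B D : Fin 2 → ℝ) : MvPolynomial (Fin 2) ℝ :=
  C (B 0 * D 1 - B 1 * D 0) + C (B 1 - D 1) * X 0 + C (D 0 - B 0) * X 1

lemma eval_areaPoly (B D x : Fin 2 → ℝ) : eval x (areaPoly B D) = area x B D := by
  simp [areaPoly, area]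
  ring

lemma degree_areaPoly (B D : Fin 2 → ℝ) : (areaPoly B D).totalDegree ≤ 1 := by
  have h : ∀ (k : ℝ) (i : Fin 2), (C k * X i : MvPolynomial (Fin 2) ℝ).totalDegree ≤ 1 := by
    intro k i
    refine (totalDegree_mul _ _).trans ?_
    simp [totalDegree_C, totalDegree_X]
  unfold areaPoly
  refine (totalDegree_add _ _).trans (max_le ((totalDegree_add _ _).trans (max_le ?_ (h _ _))) (h _ _))
  rw [totalDegree_C]
  exact Nat.zero_le _

lemma degree_term (k : ℝ) {p q : MvPolynomial (Fin 2) ℝ} (hp : p.totalDegree ≤ 1)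
    (hq : q.totalDegree ≤ 1) : (C k * (p * q)).totalDegree ≤ 2 := by
  refine (totalDegree_mul _ _).trans ?_
  have := totalDegree_mul p q
  rw [totalDegree_C]
  omega

lemma exists_poly (A B D : Fin 2 → ℝ) (p q r d e g : ℝ) :
    ∃ P : MvPolynomial (Fin 2) ℝ, P.totalDegree ≤ 2 ∧
      ∀ (u v w : ℝ) (x : Fin 2 → ℝ), u + v + w = 1 →
      x 0 = u * A 0 + v * B 0 + w * D 0 → x 1 = u * A 1 + v * B 1 + w * D 1 →
      eval x P = (area A B D) ^ 2 *
        (p * u ^ 2 + q * v ^ 2 + r * w ^ 2 + d * (v * w) + e * (w * u) + g * (u * v)) := by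
  have hU := degree_areaPoly B D
  have hV := degree_areaPoly D A
  have hW := degree_areaPoly A B
  refine ⟨C p * (areaPoly B D * areaPoly B D) + C q * (areaPoly D A * areaPoly D A) +
    C r * (areaPoly A B * areaPoly A B) + C d * (areaPoly D A * areaPoly A B) +
    C e * (areaPoly A B * areaPoly B D) + C g * (areaPoly B D * areaPoly D A), ?_, ?_⟩
  · have hadd : ∀ {a b : MvPolynomial (Fin 2) ℝ}, a.totalDegree ≤ 2 → b.totalDegree ≤ 2 →
        (a + b).totalDegree ≤ 2 := fun ha hb => (totalDegree_add _ _).trans (max_le ha hb)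
    exact hadd (hadd (hadd (hadd (hadd (degree_term _ hU hU) (degree_term _ hV hV))
      (degree_term _ hW hW)) (degree_term _ hV hW)) (degree_term _ hW hU)) (degree_term _ hU hV)
  · intro u v w x hs h0 h1
    obtain rfl : w = 1 - u - v := by linarith
    have e1 : area x B D = u * area A B D := by
      simp only [area]; rw [h0, h1]; ring
    have e2 : area x D A = v * area A B D := by
      simp only [area]; rw [h0, h1]; ring
    have e3 : area x A B = (1 - u - v) * area A B D := by
      simp only [area]; rw [h0, h1]; ring
    simp only [map_add, map_mul, eval_C, eval_areaPoly, e1, e2, e3]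
    ring

/-- **Carnot's Theorem.** Let `A, B, C` be affinely independent points of `ℝ²` and let
`a₁, a₂` (on line `BC`), `b₁, b₂` (on line `CA`), `c₁, c₂` (on line `AB`) be six pairwise
distinct points, none a vertex.  They lie on a conic (a nonzero polynomial in two
variables of degree at most 2 vanishes at all six) iff the product of the six signed
ratios `αᵢ/(1−αᵢ) · βᵢ/(1−βᵢ) · γᵢ/(1−γᵢ)` equals `1`. -/
theorem carnot (A B C : Fin 2 → ℝ)
    (hABC : AffineIndependent ℝ ![A, B, C])
    (α₁ α₂ β₁ β₂ γ₁ γ₂ : ℝ)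
    (hα₁ : α₁ ≠ 0) (hα₁' : α₁ ≠ 1) (hα₂ : α₂ ≠ 0) (hα₂' : α₂ ≠ 1)
    (hβ₁ : β₁ ≠ 0) (hβ₁' : β₁ ≠ 1) (hβ₂ : β₂ ≠ 0) (hβ₂' : β₂ ≠ 1)
    (hγ₁ : γ₁ ≠ 0) (hγ₁' : γ₁ ≠ 1) (hγ₂ : γ₂ ≠ 0) (hγ₂' : γ₂ ≠ 1)
    (a₁ a₂ b₁ b₂ c₁ c₂ : Fin 2 → ℝ)
    (ha₁ : a₁ = B + α₁ • (C - B)) (ha₂ : a₂ = B + α₂ • (C - B))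
    (hb₁ : b₁ = C + β₁ • (A - C)) (hb₂ : b₂ = C + β₂ • (A - C))
    (hc₁ : c₁ = A + γ₁ • (B - A)) (hc₂ : c₂ = A + γ₂ • (B - A))
    (hdist : List.Pairwise (· ≠ ·) [a₁, a₂, b₁, b₂, c₁, c₂]) :
    (∃ p : MvPolynomial (Fin 2) ℝ, p ≠ 0 ∧ p.totalDegree ≤ 2 ∧
      eval a₁ p = 0 ∧ eval a₂ p = 0 ∧ eval b₁ p = 0 ∧
      eval b₂ p = 0 ∧ eval c₁ p = 0 ∧ eval c₂ p = 0) ↔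
    (α₁ / (1 - α₁)) * (α₂ / (1 - α₂)) * (β₁ / (1 - β₁)) * (β₂ / (1 - β₂)) *
      (γ₁ / (1 - γ₁)) * (γ₂ / (1 - γ₂)) = 1 := by
  rw [ratio_iff hα₁' hα₂' hβ₁' hβ₂' hγ₁' hγ₂']
  have hD := area_ne_zero hABC
  have e1 := sub_ne_zero.2 hα₁'.symm
  have e2 := sub_ne_zero.2 hα₂'.symm
  have e3 := sub_ne_zero.2 hβ₁'.symm
  have e4 := sub_ne_zero.2 hβ₂'.symm
  have e5 := sub_ne_zero.2 hγ₁'.symm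
  have e6 := sub_ne_zero.2 hγ₂'.symm
  have nα : α₁ ≠ α₂ := by
    rintro rfl
    simp [ha₁, ha₂] at hdist
  have nβ : β₁ ≠ β₂ := by
    rintro rfl
    simp [hb₁, hb₂] at hdist
  have nγ : γ₁ ≠ γ₂ := by
    rintro rfl
    simp [hc₁, hc₂] at hdist
  clear hdist hABC
  have ca : ∀ (t : ℝ) (i : Fin 2), (B + t • (C - B)) i = 0 * A i + (1 - t) * B i + t * C i := by
    intro t i; simp; ring
  have cb : ∀ (t : ℝ) (i : Fin 2), (C + t • (A - C)) i = t * A i + 0 * B i + (1 - t) * C i := by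
    intro t i; simp; ring
  have cc : ∀ (t : ℝ) (i : Fin 2), (A + t • (B - A)) i = (1 - t) * A i + t * B i + 0 * C i := by
    intro t i; simp; ring
  subst ha₁ ha₂ hb₁ hb₂ hc₁ hc₂
  constructor
  · rintro ⟨P, hP, hdeg, z1, z2, z3, z4, z5, z6⟩
    obtain ⟨p, q, r, d, e, g, h⟩ := (isQuadFun_eval P hdeg).bary A B C
    have fa := fun t => h 0 (1 - t) t _ (by ring) (ca t 0) (ca t 1)
    have fb := fun t => h t 0 (1 - t) _ (by ring) (cb t 0) (cb t 1)
    have fc := fun t => h (1 - t) t 0 _ (by ring) (cc t 0) (cc t 1)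
    have y1 := (fa α₁).symm.trans z1
    have y2 := (fa α₂).symm.trans z2
    have y3 := (fb β₁).symm.trans z3
    have y4 := (fb β₂).symm.trans z4
    have y5 := (fc γ₁).symm.trans z5
    have y6 := (fc γ₂).symm.trans z6
    have s1 : q * ((1 - α₁) * (1 - α₂)) = r * (α₁ * α₂) :=
      side (d := d) nα (by linarith) (by linarith)
    have s2 : r * ((1 - β₁) * (1 - β₂)) = p * (β₁ * β₂) :=
      side (d := e) nβ (by linarith) (by linarith)
    have s3 : p * ((1 - γ₁) * (1 - γ₂)) = q * (γ₁ * γ₂) :=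
      side (d := g) nγ (by linarith) (by linarith)
    by_cases hp : p = 0
    · exfalso
      subst hp
      have hq : q = 0 := by
        have : q * (γ₁ * γ₂) = 0 := by linarith
        simpa [hγ₁, hγ₂] using this
      subst hq
      have hr : r = 0 := by
        have : r * (α₁ * α₂) = 0 := by linarith
        simpa [hα₁, hα₂] using this
      subst hr
      have hd : d = 0 := by
        have : d * ((1 - α₁) * α₁) = 0 := by linarith
        simpa [hα₁, e1] using this
      have he : e = 0 := by
        have : e * ((1 - β₁) * β₁) = 0 := by linarith
        simpa [hβ₁, e3] using this
      have hg : g = 0 := by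
        have : g * ((1 - γ₁) * γ₁) = 0 := by linarith
        simpa [hγ₁, e5] using this
      subst hd he hg
      apply hP
      apply MvPolynomial.funext
      intro x
      have hx := h (area x B C / area A B C) (area x C A / area A B C) (area x A B / area A B C) x
        (by field_simp; simp only [area]; ring)
        (by field_simp; simp only [area]; ring)
        (by field_simp; simp only [area]; ring)
      simpa using hx
    · have : (p * p * p) * 1 ≠ 0 := by positivity
      have hq : q ≠ 0 := by
        rintro rfl
        have : p * ((1 - γ₁) * (1 - γ₂)) = 0 := by linarith
        simp [hp, e5, e6] at this
      have hr : r ≠ 0 := by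
        rintro rfl
        have : q * ((1 - α₁) * (1 - α₂)) = 0 := by linarith
        simp [hq, e1, e2] at this
      have hpqr : p * q * r ≠ 0 := by positivity
      apply mul_left_cancel₀ hpqr
      calc p * q * r * (α₁ * α₂ * (β₁ * β₂) * (γ₁ * γ₂))
          = (r * (α₁ * α₂)) * (p * (β₁ * β₂)) * (q * (γ₁ * γ₂)) := by ring
        _ = _ := by rw [← s1, ← s2, ← s3]; ring
  · intro hprod
    have s3 : (γ₁ * γ₂) * ((1 - γ₁) * (1 - γ₂)) = ((1 - γ₁) * (1 - γ₂)) * (γ₁ * γ₂) := by ring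
    obtain ⟨r, hr⟩ : ∃ r, r = (β₁ * β₂) * (γ₁ * γ₂) / ((1 - β₁) * (1 - β₂)) := ⟨_, rfl⟩
    have s2 : r * ((1 - β₁) * (1 - β₂)) = (γ₁ * γ₂) * (β₁ * β₂) := by
      rw [hr]; field_simp
    have s1 : ((1 - γ₁) * (1 - γ₂)) * ((1 - α₁) * (1 - α₂)) = r * (α₁ * α₂) := by
      rw [hr]; field_simp; linarith
    obtain ⟨d, d1, d2⟩ := side_conv hα₁ hα₂ s1
    obtain ⟨e, f1, f2⟩ := side_conv hβ₁ hβ₂ s2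
    obtain ⟨g, g1, g2⟩ := side_conv hγ₁ hγ₂ s3
    obtain ⟨P, hdeg, h⟩ := exists_poly A B C (γ₁ * γ₂) ((1 - γ₁) * (1 - γ₂)) r d e g
    have fa := fun t => h 0 (1 - t) t _ (by ring) (ca t 0) (ca t 1)
    have fb := fun t => h t 0 (1 - t) _ (by ring) (cb t 0) (cb t 1)
    have fc := fun t => h (1 - t) t 0 _ (by ring) (cc t 0) (cc t 1)
    refine ⟨P, ?_, hdeg, ?_, ?_, ?_, ?_, ?_, ?_⟩
    · rintro rfl
      have hA := h 1 0 0 A (by ring) (by ring) (by ring)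
      simp [hD, hγ₁, hγ₂] at hA
    · rw [fa]; linear_combination (area A B C) ^ 2 * d1
    · rw [fa]; linear_combination (area A B C) ^ 2 * d2
    · rw [fb]; linear_combination (area A B C) ^ 2 * f1
    · rw [fb]; linear_combination (area A B C) ^ 2 * f2
    · rw [fc]; linear_combination (area A B C) ^ 2 * g1
    · rw [fc]; linear_combination (area A B C) ^ 2 * g2
end

section
/- Let A, B, C, D, E ∈ ℂ³. (1) If [ABD] = 0 (i.e., A, B, D are linearly dependent), then [BCD]·[ADE] = [ACD]·[BDE]. (2) Conversely, if [BCD]·[ADE] = [ACD]·[BDE] and [CDE] ≠ 0, then [ABD] = 0. -/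
open Matrix

/-- The bracket `[ABC]`: the determinant of the 3×3 matrix whose columns are `A`, `B`, `C`. -/
def bracket (A B C : Fin 3 → ℂ) : ℂ :=
  Matrix.det (Matrix.of ![A, B, C])ᵀ

/-- (1) If `[ABD] = 0` then `[BCD]·[ADE] = [ACD]·[BDE]`.
(2) Conversely, if `[BCD]·[ADE] = [ACD]·[BDE]` and `[CDE] ≠ 0`, then `[ABD] = 0`. -/
theorem bracket_binomial_relation (A B C D E : Fin 3 → ℂ) :
    (bracket A B D = 0 →
      bracket B C D * bracket A D E = bracket A C D * bracket B D E) ∧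
    ((bracket B C D * bracket A D E = bracket A C D * bracket B D E) →
      bracket C D E ≠ 0 → bracket A B D = 0) := by
  have key : bracket B C D * bracket A D E - bracket A C D * bracket B D E
      = -(bracket A B D * bracket C D E) := by
    simp [bracket, Matrix.det_fin_three]
    ring
  constructor
  · intro h
    rw [h] at key
    exact sub_eq_zero.mp (by simpa using key)
  · intro h hne
    rw [h, sub_self] at key
    have h0 : bracket A B D * bracket C D E = 0 := neg_eq_zero.mp key.symm
    exact (mul_eq_zero.mp h0).resolve_right hne
end

section
/- Let A, B, C, D ∈ ℂ³ be four vectors such that every three of them are linearly independent (representing four points of ℙ²(ℂ) with no three collinear). Then for every homogeneous degree-2 polynomial q in three variables over ℂ that vanishes at A, B, C, and D, there exist scalars γ, δ ∈ ℂ such that q(X) = γ·[ABX]·[CDX] + δ·[ACX]·[BDX] for all X ∈ ℂ³. -/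
open MvPolynomial Matrix

theorem bracket_eq (A B C : Fin 3 → ℂ) : bracket A B C =
    A 0 * (B 1 * C 2 - B 2 * C 1) - A 1 * (B 0 * C 2 - B 2 * C 0)
      + A 2 * (B 0 * C 1 - B 1 * C 0) := by
  rw [bracket, Matrix.det_transpose, Matrix.det_fin_three]
  simp
  ring

theorem bracket_ne_zero {A B C : Fin 3 → ℂ} (h : LinearIndependent ℂ ![A, B, C]) :
    bracket A B C ≠ 0 := by
  rw [bracket, Matrix.det_transpose]
  have h2 : IsUnit (Matrix.of ![A, B, C]) :=
    Matrix.linearIndependent_rows_iff_isUnit.mp h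
  exact ((Matrix.isUnit_iff_isUnit_det _).mp h2).ne_zero

theorem exists_coords {A B C : Fin 3 → ℂ} (h : bracket A B C ≠ 0) (X : Fin 3 → ℂ) :
    ∃ x y z : ℂ, ∀ i, X i = x * A i + y * B i + z * C i := by
  refine ⟨bracket X B C / bracket A B C, bracket A X C / bracket A B C,
    bracket A B X / bracket A B C, fun i => ?_⟩
  have key : bracket A B C * X i =
      bracket X B C * A i + bracket A X C * B i + bracket A B X * C i := by
    simp only [bracket_eq]
    fin_cases i <;> simp <;> ring
  field_simp
  linear_combination key

theorem exists_quadratic (q : MvPolynomial (Fin 3) ℂ) (hq : q.IsHomogeneous 2) :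
    ∃ a b c d e f : ℂ, ∀ X : Fin 3 → ℂ, eval X q =
      a * X 0 ^ 2 + b * X 1 ^ 2 + c * X 2 ^ 2 + d * (X 0 * X 1) + e * (X 0 * X 2)
        + f * (X 1 * X 2) := by
  rw [q.as_sum]
  refine Finset.sum_induction _ (fun p : MvPolynomial (Fin 3) ℂ =>
    ∃ a b c d e f : ℂ, ∀ X : Fin 3 → ℂ, eval X p =
      a * X 0 ^ 2 + b * X 1 ^ 2 + c * X 2 ^ 2 + d * (X 0 * X 1) + e * (X 0 * X 2)
        + f * (X 1 * X 2)) ?_ ?_ ?_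
  · rintro p r ⟨a, b, c, d, e, f, h⟩ ⟨a₂, b₂, c₂, d₂, e₂, f₂, h₂⟩
    refine ⟨a + a₂, b + b₂, c + c₂, d + d₂, e + e₂, f + f₂, fun X => ?_⟩
    rw [map_add, h, h₂]
    ring
  · exact ⟨0, 0, 0, 0, 0, 0, fun X => by simp⟩
  · intro m hm
    have hdeg := hq (mem_support_iff.mp hm)
    rw [Finsupp.weight_apply, Finsupp.sum_fintype _ _ (by simp)] at hdeg
    simp [Fin.sum_univ_three] at hdeg
    generalize coeff m q = k
    have hev : ∀ X : Fin 3 → ℂ, eval X (monomial m k) =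
        k * (X 0 ^ m 0 * X 1 ^ m 1 * X 2 ^ m 2) := by
      intro X
      rw [eval_monomial, Finsupp.prod_fintype _ _ (by simp), Fin.prod_univ_three]
    simp only [hev]
    have hc : (m 0 = 2 ∧ m 1 = 0 ∧ m 2 = 0) ∨ (m 0 = 0 ∧ m 1 = 2 ∧ m 2 = 0) ∨
        (m 0 = 0 ∧ m 1 = 0 ∧ m 2 = 2) ∨ (m 0 = 1 ∧ m 1 = 1 ∧ m 2 = 0) ∨
        (m 0 = 1 ∧ m 1 = 0 ∧ m 2 = 1) ∨ (m 0 = 0 ∧ m 1 = 1 ∧ m 2 = 1) := by omega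
    rcases hc with ⟨h0, h1, h2⟩ | ⟨h0, h1, h2⟩ | ⟨h0, h1, h2⟩ | ⟨h0, h1, h2⟩ |
      ⟨h0, h1, h2⟩ | ⟨h0, h1, h2⟩ <;> simp only [h0, h1, h2]
    · exact ⟨k, 0, 0, 0, 0, 0, fun X => by ring⟩
    · exact ⟨0, k, 0, 0, 0, 0, fun X => by ring⟩
    · exact ⟨0, 0, k, 0, 0, 0, fun X => by ring⟩
    · exact ⟨0, 0, 0, k, 0, 0, fun X => by ring⟩
    · exact ⟨0, 0, 0, 0, k, 0, fun X => by ring⟩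
    · exact ⟨0, 0, 0, 0, 0, k, fun X => by ring⟩

/-- In a basis consisting of zeros, a ternary quadratic form has only mixed terms. -/
theorem exists_mixed (A B C : Fin 3 → ℂ) (q : MvPolynomial (Fin 3) ℂ)
    (hq : q.IsHomogeneous 2) (hqA : eval A q = 0) (hqB : eval B q = 0) (hqC : eval C q = 0) :
    ∃ P Q R : ℂ, ∀ (X : Fin 3 → ℂ) (x y z : ℂ), (∀ i, X i = x * A i + y * B i + z * C i) →
      eval X q = x * y * P + x * z * Q + y * z * R := by
  obtain ⟨a, b, c, d, e, f, h⟩ := exists_quadratic q hq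
  let pol : (Fin 3 → ℂ) → (Fin 3 → ℂ) → ℂ := fun U V =>
    2 * a * U 0 * V 0 + 2 * b * U 1 * V 1 + 2 * c * U 2 * V 2 + d * (U 0 * V 1 + U 1 * V 0)
      + e * (U 0 * V 2 + U 2 * V 0) + f * (U 1 * V 2 + U 2 * V 1)
  refine ⟨pol A B, pol A C, pol B C, fun X x y z hX => ?_⟩
  rw [h] at hqA hqB hqC ⊢
  simp only [hX, pol]
  linear_combination x ^ 2 * hqA + y ^ 2 * hqB + z ^ 2 * hqC

/-- If `A, B, C, D ∈ ℂ³` are four vectors, every three of which are linearly independent,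
then every homogeneous degree-2 polynomial vanishing at all four of them is of the form
`γ·[ABX]·[CDX] + δ·[ACX]·[BDX]`. -/
theorem conic_pencil_through_four_points
    (A B C D : Fin 3 → ℂ)
    (hABC : LinearIndependent ℂ ![A, B, C])
    (hABD : LinearIndependent ℂ ![A, B, D])
    (hACD : LinearIndependent ℂ ![A, C, D])
    (hBCD : LinearIndependent ℂ ![B, C, D])
    (q : MvPolynomial (Fin 3) ℂ) (hq : q.IsHomogeneous 2)
    (hqA : eval A q = 0) (hqB : eval B q = 0)
    (hqC : eval C q = 0) (hqD : eval D q = 0) :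
    ∃ γ δ : ℂ, ∀ X : Fin 3 → ℂ,
      eval X q = γ * (bracket A B X * bracket C D X)
        + δ * (bracket A C X * bracket B D X) := by
  have hΔ := bracket_ne_zero hABC
  have h1 := bracket_ne_zero hABD
  have h2 := bracket_ne_zero hACD
  obtain ⟨P, Q, R, hmix⟩ := exists_mixed A B C q hq hqA hqB hqC
  obtain ⟨d, e, f, hD⟩ := exists_coords hΔ D
  have hf : f ≠ 0 := by
    rintro rfl
    apply h1
    simp only [bracket_eq, hD]
    ring
  have he : e ≠ 0 := by
    rintro rfl
    apply h2
    simp only [bracket_eq, hD]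
    ring
  rw [hmix D d e f hD] at hqD
  refine ⟨-Q / (e * bracket A B C ^ 2), -P / (f * bracket A B C ^ 2), fun X => ?_⟩
  obtain ⟨x, y, z, hX⟩ := exists_coords hΔ X
  have b1 : bracket A B X = z * bracket A B C := by
    simp only [bracket_eq, hX]; ring
  have b2 : bracket C D X = (d * y - e * x) * bracket A B C := by
    simp only [bracket_eq, hX, hD]; ring
  have b3 : bracket A C X = -y * bracket A B C := by
    simp only [bracket_eq, hX]; ring
  have b4 : bracket B D X = -(d * z - f * x) * bracket A B C := by
    simp only [bracket_eq, hX, hD]; ring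
  rw [hmix X x y z hX, b1, b2, b3, b4]
  field_simp
  linear_combination y * z * hqD
end

section
/- Let q be a nonzero irreducible homogeneous degree-2 polynomial in three variables over ℂ and let P₁, P₂, P₃, P₄, P₅ be five pairwise distinct points of ℙ²(ℂ) lying on the conic q = 0, no three of them collinear. Let Qₚ be a point distinct from P₁ and let ℓ be the line through P₁ and Qₚ. Define Q₁ as the intersection point of the lines P₁P₂ and P₄P₅, Q₂ as the intersection point of the line P₃P₄ with ℓ, and Q₃ as the intersection point of the line P₂P₃ with the line Q₁Q₂; assume that in each case the two lines being intersected are distinct (so each intersection is a single point), that Q₁ ≠ Q₂, that P₅ ≠ Q₃, and that the line P₅Q₃ is distinct from ℓ. Then the point R = (line P₅Q₃) ∩ ℓ lies on the conic, i.e., q(R) = 0. -/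
open MvPolynomial

/-- The line of `ℙ²(ℂ)` through two points, as the set of vectors that are linear
combinations of their representatives. -/
noncomputable def Line (v w : Fin 3 → ℂ) : Submodule ℂ (Fin 3 → ℂ) :=
  Submodule.span ℂ {v, w}

lemma quad_form_aux (q : MvPolynomial (Fin 3) ℂ) (hqh : q.IsHomogeneous 2) :
    ∃ A B C D E F : ℂ, ∀ v : Fin 3 → ℂ, eval v q =
      A * v 0 ^ 2 + B * v 1 ^ 2 + C * v 2 ^ 2 + D * (v 1 * v 2) + E * (v 0 * v 2)
        + F * (v 0 * v 1) := by
  have key : ∀ S : Finset (Fin 3 →₀ ℕ), S ⊆ q.support →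
      ∃ A B C D E F : ℂ, ∀ v : Fin 3 → ℂ, ∑ d ∈ S, coeff d q * ∏ i, v i ^ d i =
      A * v 0 ^ 2 + B * v 1 ^ 2 + C * v 2 ^ 2 + D * (v 1 * v 2) + E * (v 0 * v 2)
        + F * (v 0 * v 1) := by
    intro S
    induction S using Finset.induction_on with
    | empty => intro _; exact ⟨0, 0, 0, 0, 0, 0, by simp⟩
    | insert d S hd ih =>
      intro hS
      obtain ⟨A, B, C, D, E, F, h⟩ := ih (fun x hx => hS (Finset.mem_insert_of_mem hx))
      have hdeg : d 0 + d 1 + d 2 = 2 := by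
        have h1 := hqh (mem_support_iff.mp (hS (Finset.mem_insert_self d S)))
        rw [Finsupp.weight_apply, Finsupp.sum_fintype _ _ (by simp)] at h1
        simpa [Fin.sum_univ_three] using h1
      have h0 : d 0 ≤ 2 := by omega
      have h1 : d 1 ≤ 2 := by omega
      have h2 : d 2 = 2 - d 0 - d 1 := by omega
      simp only [Finset.sum_insert hd, h]
      simp only [Fin.prod_univ_three]
      generalize coeff d q = c
      rw [h2]
      generalize d 0 = m at *
      generalize d 1 = n at *
      interval_cases m <;> interval_cases n <;> first | omega | skip
      · exact ⟨A, B, C + c, D, E, F, fun v => by norm_num; ring⟩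
      · exact ⟨A, B, C, D + c, E, F, fun v => by norm_num; ring⟩
      · exact ⟨A, B + c, C, D, E, F, fun v => by norm_num; ring⟩
      · exact ⟨A, B, C, D, E + c, F, fun v => by norm_num; ring⟩
      · exact ⟨A, B, C, D, E, F + c, fun v => by norm_num; ring⟩
      · exact ⟨A + c, B, C, D, E, F, fun v => by norm_num; ring⟩
  obtain ⟨A, B, C, D, E, F, h⟩ := key q.support (Finset.Subset.refl _)
  exact ⟨A, B, C, D, E, F, fun v => by rw [eval_eq', h]⟩

lemma quad_form_polar (q : MvPolynomial (Fin 3) ℂ) (hqh : q.IsHomogeneous 2)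
    (u v w : Fin 3 → ℂ) (hu : eval u q = 0) (hv : eval v q = 0) (hw : eval w q = 0) :
    ∃ α β γ : ℂ, ∀ x y z : ℂ, eval (x • u + y • v + z • w) q =
      α * (y * z) + β * (x * z) + γ * (x * y) := by
  obtain ⟨A, B, C, D, E, F, h⟩ := quad_form_aux q hqh
  rw [h] at hu hv hw
  refine ⟨2 * A * v 0 * w 0 + 2 * B * v 1 * w 1 + 2 * C * v 2 * w 2
      + D * (v 1 * w 2 + v 2 * w 1) + E * (v 0 * w 2 + v 2 * w 0) + F * (v 0 * w 1 + v 1 * w 0),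
    2 * A * u 0 * w 0 + 2 * B * u 1 * w 1 + 2 * C * u 2 * w 2
      + D * (u 1 * w 2 + u 2 * w 1) + E * (u 0 * w 2 + u 2 * w 0) + F * (u 0 * w 1 + u 1 * w 0),
    2 * A * u 0 * v 0 + 2 * B * u 1 * v 1 + 2 * C * u 2 * v 2
      + D * (u 1 * v 2 + u 2 * v 1) + E * (u 0 * v 2 + u 2 * v 0) + F * (u 0 * v 1 + u 1 * v 0),
    fun x y z => ?_⟩
  rw [h]
  simp only [Pi.add_apply, Pi.smul_apply, smul_eq_mul]
  linear_combination x ^ 2 * hu + y ^ 2 * hv + z ^ 2 * hw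

lemma indep_three {u v w : Fin 3 → ℂ} (h : LinearIndependent ℂ ![u, v, w]) {x y z : ℂ}
    (e : x • u + y • v + z • w = 0) : x = 0 ∧ y = 0 ∧ z = 0 := by
  rw [Fintype.linearIndependent_iff] at h
  have h1 := h ![x, y, z] (by simpa [Fin.sum_univ_three] using e)
  exact ⟨h1 0, h1 1, h1 2⟩

lemma span_three {u v w : Fin 3 → ℂ} (h : LinearIndependent ℂ ![u, v, w]) (p : Fin 3 → ℂ) :
    ∃ x y z : ℂ, p = x • u + y • v + z • w := by
  let b := basisOfLinearIndependentOfCardEqFinrank h (by simp)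
  have h1 := b.sum_repr p
  refine ⟨b.repr p 0, b.repr p 1, b.repr p 2, ?_⟩
  conv_lhs => rw [← h1]
  simp [Fin.sum_univ_three, b]

lemma pascal_scalar (α β γ a b c d e f i j k l s t m n u v x y g h r : ℂ)
    (h3 : α * (b * c) + β * (a * c) + γ * (a * b) = 0)
    (h4 : α * (e * f) + β * (d * f) + γ * (d * e) = 0)
    (hb : b ≠ 0) (he : e ≠ 0) (hc : c ≠ 0) (hA : c * d - f * a ≠ 0) (hv : v ≠ 0)
    (h1x : i = k * a + l * d) (h1y : j = k * b + l * e) (h1z : 0 = k * c + l * f)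
    (h3x : 0 = u * i + v * (t * a)) (h3y : m = u * j + v * (t * b))
    (h3z : n = v * (t * c + s))
    (hx : x * d = r) (hy : x * e + y * m = h * (t * b))
    (hz : x * f + y * n = h * (t * c + s)) :
    α * (h * (t * b) * (h * (t * c + s))) + β * (r * (h * (t * c + s)))
      + γ * (r * (h * (t * b))) = 0 := by
  have hci : c * i = l * (c * d - f * a) := by rw [h1x]; linear_combination -a * h1z
  have hcj : c * j = l * (c * e - f * b) := by rw [h1y]; linear_combination -b * h1z
  -- coordinates of Q₃
  have hm : (c * d - f * a) * m =
      v * ((c * d - f * a) * (t * b) - (c * e - f * b) * (t * a)) := by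
    apply mul_left_cancel₀ hc
    rw [h3y]
    linear_combination (c * d - f * a) * u * hcj - (c * e - f * b) * u * hci
      - c * (c * e - f * b) * h3x
  have hdet : d * (m * (h * (t * c + s)) - n * (h * (t * b))) + r * (e * n - f * m) = 0 := by
    rw [← hx, ← hy, ← hz]; ring
  have hdet2 : -d * h * (c * e - f * b) * (t * a) * (t * c + s)
      + r * (e * (c * d - f * a) * (t * c + s) - f * (c * d - f * a) * (t * b)
        + f * (c * e - f * b) * (t * a)) = 0 := by
    apply mul_left_cancel₀ hv
    rw [h3z] at hdet
    linear_combination (c * d - f * a) * hdet - (d * h * (t * c + s) - r * f) * hm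
  obtain ⟨κ, hκ⟩ : ∃ κ, β = κ * (-(b * e * (c * d - f * a))) :=
    ⟨β / (-(b * e * (c * d - f * a))), by field_simp⟩
  have hα : α = κ * (a * d * (c * e - f * b)) := by
    apply mul_left_cancel₀ (mul_ne_zero (mul_ne_zero hb he) hA)
    rw [hκ] at h3 h4
    linear_combination d * e * h3 - a * b * h4
  have hγ : γ = κ * (c * f * (b * d - a * e)) := by
    apply mul_left_cancel₀ (mul_ne_zero (mul_ne_zero hb he) hA)
    rw [hκ] at h3 h4
    linear_combination b * c * h4 - e * f * h3
  rw [hα, hκ, hγ]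
  linear_combination -b * κ * h * hdet2

/-- **Construction 1 (via Pascal's theorem).** Let `P₁, …, P₅` be five pairwise
distinct points on an irreducible conic `q = 0`, no three collinear, and let `ℓ` be the
line through `P₁` and a point `Qₚ ≠ P₁`.  Let `Q₁ = P₁P₂ ∩ P₄P₅`, `Q₂ = P₃P₄ ∩ ℓ`, and
`Q₃ = P₂P₃ ∩ Q₁Q₂` (the pairs of intersected lines being distinct), with `Q₁ ≠ Q₂`,
`P₅ ≠ Q₃`, and line `P₅Q₃` distinct from `ℓ`.  Then the point `R = P₅Q₃ ∩ ℓ` lies on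
the conic. -/
theorem second_intersection_on_conic
    (q : MvPolynomial (Fin 3) ℂ) (hq0 : q ≠ 0) (hqh : q.IsHomogeneous 2)
    (hqirr : Irreducible q)
    (P : Fin 5 → (Fin 3 → ℂ))
    (hP0 : ∀ i, P i ≠ 0)
    (hPdist : ∀ i j : Fin 5, i ≠ j → ¬ ProjEq (P i) (P j))
    (hPconic : ∀ i, eval (P i) q = 0)
    (hP3 : ∀ i j k : Fin 5, i ≠ j → i ≠ k → j ≠ k →
      LinearIndependent ℂ ![P i, P j, P k])
    (Qp : Fin 3 → ℂ) (hQp : Qp ≠ 0) (hQpP₁ : ¬ ProjEq (P 0) Qp)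
    -- Q₁ = P₁P₂ ∩ P₄P₅
    (Q₁ : Fin 3 → ℂ) (hQ₁0 : Q₁ ≠ 0)
    (hL₁ : Line (P 0) (P 1) ≠ Line (P 3) (P 4))
    (hQ₁ : Q₁ ∈ Line (P 0) (P 1)) (hQ₁' : Q₁ ∈ Line (P 3) (P 4))
    -- Q₂ = P₃P₄ ∩ ℓ, where ℓ = P₁Qₚ
    (Q₂ : Fin 3 → ℂ) (hQ₂0 : Q₂ ≠ 0)
    (hL₂ : Line (P 2) (P 3) ≠ Line (P 0) Qp)
    (hQ₂ : Q₂ ∈ Line (P 2) (P 3)) (hQ₂' : Q₂ ∈ Line (P 0) Qp)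
    (hQ₁Q₂ : ¬ ProjEq Q₁ Q₂)
    -- Q₃ = P₂P₃ ∩ Q₁Q₂
    (Q₃ : Fin 3 → ℂ) (hQ₃0 : Q₃ ≠ 0)
    (hL₃ : Line (P 1) (P 2) ≠ Line Q₁ Q₂)
    (hQ₃ : Q₃ ∈ Line (P 1) (P 2)) (hQ₃' : Q₃ ∈ Line Q₁ Q₂)
    (hP₅Q₃ : ¬ ProjEq (P 4) Q₃)
    -- R = P₅Q₃ ∩ ℓ
    (hL₄ : Line (P 4) Q₃ ≠ Line (P 0) Qp)
    (R : Fin 3 → ℂ) (hR0 : R ≠ 0)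
    (hR : R ∈ Line (P 4) Q₃) (hR' : R ∈ Line (P 0) Qp) :
    eval R q = 0 := by
  obtain ⟨α, β, γ, hQ⟩ := quad_form_polar q hqh (P 0) (P 1) (P 2) (hPconic 0) (hPconic 1)
    (hPconic 2)
  have I := hP3 0 1 2 (by decide) (by decide) (by decide)
  have cmp : ∀ {x y z x' y' z' : ℂ}, x • P 0 + y • P 1 + z • P 2 =
      x' • P 0 + y' • P 1 + z' • P 2 → x = x' ∧ y = y' ∧ z = z' := by
    intro x y z x' y' z' hh
    have := indep_three I (x := x - x') (y := y - y') (z := z - z') (by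
      rw [← sub_eq_zero] at hh; rw [← hh]; module)
    simpa [sub_eq_zero] using this
  obtain ⟨a, b, c, h3⟩ := span_three I (P 3)
  obtain ⟨d, e, f, h4⟩ := span_three I (P 4)
  have hb : b ≠ 0 := by
    rintro rfl
    have := indep_three (hP3 0 2 3 (by decide) (by decide) (by decide))
      (x := a) (y := c) (z := -1) (by rw [h3]; module)
    simp at this
  have he : e ≠ 0 := by
    rintro rfl
    have := indep_three (hP3 0 2 4 (by decide) (by decide) (by decide))
      (x := d) (y := f) (z := -1) (by rw [h4]; module)
    simp at this
  have hc : c ≠ 0 := by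
    rintro rfl
    have := indep_three (hP3 0 1 3 (by decide) (by decide) (by decide))
      (x := a) (y := b) (z := -1) (by rw [h3]; module)
    simp at this
  have hA : c * d - f * a ≠ 0 := by
    intro h0
    have h0' : c * d = f * a := sub_eq_zero.mp h0
    have := indep_three (hP3 1 3 4 (by decide) (by decide) (by decide))
      (x := f * b - c * e) (y := -f) (z := c) (by
        rw [h3, h4]
        have : (f * b - c * e) • P 1 + (-f) • (a • P 0 + b • P 1 + c • P 2)
          + c • (d • P 0 + e • P 1 + f • P 2) = (c * d - f * a) • P 0 := by module
        rw [this, h0, zero_smul])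
    exact hc this.2.2
  have c3 := hPconic 3
  have c4 := hPconic 4
  rw [h3, hQ] at c3
  rw [h4, hQ] at c4
  simp only [Line, Submodule.mem_span_pair] at hQ₁ hQ₁' hQ₂ hQ₂' hQ₃ hQ₃' hR hR'
  obtain ⟨i, j, e1⟩ := hQ₁
  obtain ⟨k, l, e1'⟩ := hQ₁'
  obtain ⟨s, t, e2⟩ := hQ₂
  obtain ⟨x1, y1, e2'⟩ := hQ₂'
  obtain ⟨m, n, e3⟩ := hQ₃
  obtain ⟨u, v, e3'⟩ := hQ₃'
  obtain ⟨x, y, eR⟩ := hR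
  obtain ⟨g1, h1, eR'⟩ := hR'
  have hy1 : y1 ≠ 0 := by
    rintro rfl
    have := indep_three (hP3 0 2 3 (by decide) (by decide) (by decide))
      (x := -x1) (y := s) (z := t) (by
        have : s • P 2 + t • P 3 = x1 • P 0 + (0 : ℂ) • Qp := by rw [e2, e2']
        rw [add_assoc, this]; module)
    apply hQ₂0
    rw [← e2, this.2.1, this.2.2]; simp
  have hQpe : Qp = y1⁻¹ • (Q₂ - x1 • P 0) := by
    rw [← e2', add_sub_cancel_left, smul_smul, inv_mul_cancel₀ hy1, one_smul]
  obtain ⟨g, h, eR2⟩ : ∃ g h : ℂ, R = g • P 0 + h • Q₂ :=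
    ⟨g1 - h1 * y1⁻¹ * x1, h1 * y1⁻¹, by rw [← eR', hQpe]; module⟩
  have Q2c : Q₂ = (t * a) • P 0 + (t * b) • P 1 + (t * c + s) • P 2 := by
    rw [← e2, h3]; module
  have Rc : R = (g + h * (t * a)) • P 0 + (h * (t * b)) • P 1 + (h * (t * c + s)) • P 2 := by
    rw [eR2, Q2c]; module
  obtain ⟨k1, k2, k3⟩ := cmp (x := i) (y := j) (z := 0) (x' := k * a + l * d)
    (y' := k * b + l * e) (z' := k * c + l * f) (by
      have : i • P 0 + j • P 1 = k • P 3 + l • P 4 := by rw [e1, e1']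
      rw [zero_smul, add_zero, this, h3, h4]; module)
  obtain ⟨m1, m2, m3⟩ := cmp (x := 0) (y := m) (z := n) (x' := u * i + v * (t * a))
    (y' := u * j + v * (t * b)) (z' := v * (t * c + s)) (by
      have : m • P 1 + n • P 2 = u • Q₁ + v • Q₂ := by rw [e3, e3']
      rw [zero_smul, zero_add, this, Q2c, ← e1]; module)
  obtain ⟨n1, n2, n3⟩ := cmp (x := x * d) (y := x * e + y * m) (z := x * f + y * n)
    (x' := g + h * (t * a)) (y' := h * (t * b)) (z' := h * (t * c + s)) (by
      rw [← Rc, ← eR, ← e3, h4]; module)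
  have hv : v ≠ 0 := by
    rintro rfl
    have hu : u ≠ 0 := by
      rintro rfl
      apply hQ₃0; rw [← e3']; simp
    have hi : i = 0 := by
      have : u * i = 0 := by linear_combination -m1
      exact (mul_eq_zero.mp this).resolve_left hu
    have hl : l * (c * d - f * a) = 0 := by
      linear_combination c * hi - c * k1 + a * k3
    have hl0 := (mul_eq_zero.mp hl).resolve_right hA
    have hk0 : k = 0 := by
      have : k * c = 0 := by rw [hl0] at k3; linear_combination -k3
      exact (mul_eq_zero.mp this).resolve_right hc
    apply hQ₁0; rw [← e1', hl0, hk0]; simp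
  rw [Rc, hQ]
  exact pascal_scalar α β γ a b c d e f i j k l s t m n u v x y g h (g + h * (t * a)) c3 c4
    hb he hc hA hv k1 k2 k3 m1 m2 m3 n1 n2 n3
end
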